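/- arXiv:2512.12966 — 5 statements merged into one kernel-verified Lean document; each statement's English description precedes it below -/
import Mathlib

section
/- Let G be a countable group, H ≤ G a subgroup, K ≤ G a subgroup, and m a probability measure on G with supp m ⊆ K. Let F ⊆ G be a finite set and suppose liminf_{N→+∞} (1/N)·Σ_{n=1}^{N} m^{*n}(HF) > 0, where m^{*n} denotes the n-fold convolution of m and HF = {hf : h ∈ H, f ∈ F}. Then there exists a function μ : H\G → [0,+∞) that is finite and nonzero (0 < Σ_{C ∈ H\G} μ(C) < +∞), m-stationary (μ(C) = Σ_{g ∈ G} μ(C·g⁻¹)·m(g) for every coset C ∈ H\G), and supported on the cosets of K (μ(Hg) = 0 whenever g ∉ HK). -/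
open Filter
open scoped ENNReal Pointwise Classical

/-- The `n`-fold convolution power of a measure (as a weight function) on a
countable group: `m^{*0} = δ_e` and `m^{*(n+1)} = m^{*n} * m`. -/
noncomputable def convPow {G : Type*} [Group G] (m : G → ℝ≥0∞) : ℕ → G → ℝ≥0∞
  | 0 => fun g => if g = 1 then 1 else 0
  | n + 1 => fun g => ∑' u : G, convPow m n u * m (u⁻¹ * g)

/-- Translation by `g⁻¹` on the right coset space `H\G`. -/
def rightCosetTranslate {G : Type*} [Group G] (H : Subgroup G) (g : G) :
    Quotient (QuotientGroup.rightRel H) ≃ Quotient (QuotientGroup.rightRel H) :=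
  Quotient.congr (Equiv.mulRight g⁻¹) fun a b => by
    change QuotientGroup.rightRel H a b ↔ QuotientGroup.rightRel H (a * g⁻¹) (b * g⁻¹)
    simp [QuotientGroup.rightRel_apply, mul_assoc]

lemma rightCosetTranslate_mk {G : Type*} [Group G] (H : Subgroup G) (g x : G) :
    rightCosetTranslate H g (Quotient.mk _ x) = Quotient.mk _ (x * g⁻¹) := rfl

/-- The action of `m` on weight functions on `H\G`, `(ν * m)(C) = ∑ ν(C g⁻¹) m(g)`. -/
noncomputable def cosetConv {G : Type*} [Group G] (H : Subgroup G) (m : G → ℝ≥0∞)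
    (ν : Quotient (QuotientGroup.rightRel H) → ℝ≥0∞) (C : Quotient (QuotientGroup.rightRel H)) :
    ℝ≥0∞ :=
  ∑' g : G, ν (rightCosetTranslate H g C) * m g

lemma tsum_cosetConv {G : Type*} [Group G] (H : Subgroup G) {m : G → ℝ≥0∞}
    (hm : ∑' g : G, m g = 1) (ν : Quotient (QuotientGroup.rightRel H) → ℝ≥0∞) :
    ∑' C, cosetConv H m ν C = ∑' C, ν C := by
  unfold cosetConv
  rw [ENNReal.tsum_comm]
  simp_rw [ENNReal.tsum_mul_right, Equiv.tsum_eq]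
  rw [ENNReal.tsum_mul_left, hm, mul_one]

/-- The image of `m^{*n}` on `H\G`. -/
noncomputable def cosetPow {G : Type*} [Group G] (H : Subgroup G) (m : G → ℝ≥0∞) (n : ℕ)
    (C : Quotient (QuotientGroup.rightRel H)) : ℝ≥0∞ :=
  ∑' g : G, if Quotient.mk (QuotientGroup.rightRel H) g = C then convPow m n g else 0

lemma cosetPow_succ {G : Type*} [Group G] (H : Subgroup G) (m : G → ℝ≥0∞) (n : ℕ) :
    cosetPow H m (n + 1) = cosetConv H m (cosetPow H m n) := by
  funext C
  have key : ∀ u v : G, Quotient.mk (QuotientGroup.rightRel H) (u * v) = C ↔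
      Quotient.mk (QuotientGroup.rightRel H) u = rightCosetTranslate H v C := by
    intro u v
    rw [← (rightCosetTranslate H v).apply_eq_iff_eq, rightCosetTranslate_mk,
      mul_inv_cancel_right]
  calc cosetPow H m (n + 1) C
      = ∑' g : G, ∑' u : G, if Quotient.mk (QuotientGroup.rightRel H) g = C then
          convPow m n u * m (u⁻¹ * g) else 0 := by
        unfold cosetPow
        refine tsum_congr fun g => ?_
        split_ifs <;> simp [convPow]
    _ = ∑' u : G, ∑' g : G, if Quotient.mk (QuotientGroup.rightRel H) g = C then
          convPow m n u * m (u⁻¹ * g) else 0 := ENNReal.tsum_comm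
    _ = ∑' u : G, ∑' v : G,
          if Quotient.mk (QuotientGroup.rightRel H) u = rightCosetTranslate H v C then
          convPow m n u * m v else 0 := by
        refine tsum_congr fun u => ?_
        rw [← (Equiv.mulLeft u).tsum_eq]
        refine tsum_congr fun v => ?_
        simp only [Equiv.coe_mulLeft, key, inv_mul_cancel_left]
    _ = cosetConv H m (cosetPow H m n) C := by
        rw [ENNReal.tsum_comm]
        unfold cosetConv cosetPow
        refine tsum_congr fun v => ?_
        rw [← ENNReal.tsum_mul_right]
        refine tsum_congr fun u => ?_
        rw [ite_mul, zero_mul]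

lemma tsum_cosetPow {G : Type*} [Group G] (H : Subgroup G) {m : G → ℝ≥0∞}
    (hm : ∑' g : G, m g = 1) (n : ℕ) : ∑' C, cosetPow H m n C = 1 := by
  induction n with
  | zero =>
    unfold cosetPow
    rw [ENNReal.tsum_comm]
    simp [convPow]
  | succ n ih => rw [cosetPow_succ, tsum_cosetConv H hm, ih]

lemma convPow_eq_zero_of_notMem {G : Type*} [Group G] {K : Subgroup G} {m : G → ℝ≥0∞}
    (hsupp : {g : G | m g ≠ 0} ⊆ (K : Set G)) (n : ℕ) {g : G} (hg : g ∉ K) :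
    convPow m n g = 0 := by
  induction n generalizing g with
  | zero =>
    have : g ≠ 1 := fun h => hg (h ▸ K.one_mem)
    simp [convPow, this]
  | succ n ih =>
    simp only [convPow, ENNReal.tsum_eq_zero, mul_eq_zero]
    intro u
    by_cases hu : u ∈ K
    · right
      by_contra h
      exact hg ((K.mul_mem_cancel_left (K.inv_mem hu)).1 (hsupp h))
    · exact Or.inl (ih hu)

lemma cosetPow_mk_eq_zero {G : Type*} [Group G] (H : Subgroup G) {K : Subgroup G} {m : G → ℝ≥0∞}
    (hsupp : {g : G | m g ≠ 0} ⊆ (K : Set G)) (n : ℕ) {g : G}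
    (hg : g ∉ (H : Set G) * (K : Set G)) :
    cosetPow H m n (Quotient.mk _ g) = 0 := by
  simp only [cosetPow, ENNReal.tsum_eq_zero, ite_eq_right_iff]
  intro k hk
  refine convPow_eq_zero_of_notMem hsupp n fun hkK => hg ?_
  have hH : g * k⁻¹ ∈ H := QuotientGroup.rightRel_apply.1 (Quotient.exact hk)
  exact ⟨g * k⁻¹, hH, k, hkK, by simp⟩

lemma tsum_convPow_mul_le {G : Type*} [Group G] (H : Subgroup G) (m : G → ℝ≥0∞) (F : Finset G)
    (n : ℕ) :
    ∑' g : ((H : Set G) * (F : Set G) : Set G), convPow m n (g : G) ≤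
      ∑ C ∈ F.image (Quotient.mk (QuotientGroup.rightRel H)), cosetPow H m n C := by
  rw [tsum_subtype ((H : Set G) * (F : Set G)) (convPow m n)]
  unfold cosetPow
  rw [← Summable.tsum_finsetSum fun _ _ => ENNReal.summable]
  refine ENNReal.tsum_le_tsum fun g => ?_
  refine Set.indicator_apply_le' ?_ fun _ => zero_le
  rintro ⟨h, hh, f, hf, rfl⟩
  have hmem : Quotient.mk (QuotientGroup.rightRel H) (h * f) ∈
      F.image (Quotient.mk (QuotientGroup.rightRel H)) := by
    refine Finset.mem_image.2 ⟨f, hf, Quotient.sound ?_⟩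
    exact QuotientGroup.rightRel_apply.2 (by simpa using hh)
  simp only [Finset.sum_ite_eq, hmem, if_true, le_refl]

/-- The Cesàro averages of the images of `m^{*n}` on `H\G`. -/
noncomputable def cosetCesaro {G : Type*} [Group G] (H : Subgroup G) (m : G → ℝ≥0∞) (N : ℕ)
    (C : Quotient (QuotientGroup.rightRel H)) : ℝ≥0∞ :=
  (∑ n ∈ Finset.Icc 1 N, cosetPow H m n C) / (N : ℝ≥0∞)

lemma tsum_cosetCesaro_le {G : Type*} [Group G] (H : Subgroup G) {m : G → ℝ≥0∞}
    (hm : ∑' g : G, m g = 1) (N : ℕ) : ∑' C, cosetCesaro H m N C ≤ 1 := by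
  simp only [cosetCesaro, div_eq_mul_inv]
  rw [ENNReal.tsum_mul_right, Summable.tsum_finsetSum fun _ _ => ENNReal.summable]
  simp only [tsum_cosetPow H hm, Finset.sum_const, Nat.card_Icc, add_tsub_cancel_right,
    nsmul_eq_mul, mul_one]
  exact ENNReal.mul_inv_le_one _

lemma cosetConv_cosetCesaro_le {G : Type*} [Group G] (H : Subgroup G) {m : G → ℝ≥0∞}
    (hm : ∑' g : G, m g = 1) (N : ℕ) (C : Quotient (QuotientGroup.rightRel H)) :
    cosetConv H m (cosetCesaro H m N) C ≤ cosetCesaro H m N C + (N : ℝ≥0∞)⁻¹ := by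
  have hshift : cosetConv H m (cosetCesaro H m N) C =
      (∑ n ∈ Finset.Icc 1 N, cosetPow H m (n + 1) C) * (N : ℝ≥0∞)⁻¹ := by
    simp only [cosetPow_succ, cosetConv, cosetCesaro, div_eq_mul_inv]
    rw [← Summable.tsum_finsetSum fun _ _ => ENNReal.summable, ← ENNReal.tsum_mul_right]
    refine tsum_congr fun g => ?_
    rw [← Finset.sum_mul]
    ring
  have hsum : ∑ n ∈ Finset.Icc 1 N, cosetPow H m (n + 1) C ≤
      (∑ n ∈ Finset.Icc 1 N, cosetPow H m n C) + 1 := by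
    calc ∑ n ∈ Finset.Icc 1 N, cosetPow H m (n + 1) C
        ≤ cosetPow H m 1 C + ∑ n ∈ Finset.Icc 1 N, cosetPow H m (n + 1) C := le_add_self
      _ = (∑ n ∈ Finset.Icc 1 N, cosetPow H m n C) + cosetPow H m (N + 1) C := by
          rw [← Finset.sum_Icc_succ_top (Nat.le_add_left 1 N)]
          clear hshift
          induction N with
          | zero => simp
          | succ N ih =>
            rw [Finset.sum_Icc_succ_top (by omega), ← add_assoc, ih,
              ← Finset.sum_Icc_succ_top (by omega)]
      _ ≤ _ := by
          gcongr
          exact (ENNReal.le_tsum C).trans (tsum_cosetPow H hm (N + 1)).le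
  rw [hshift, cosetCesaro, div_eq_mul_inv]
  calc _ ≤ ((∑ n ∈ Finset.Icc 1 N, cosetPow H m n C) + 1) * (N : ℝ≥0∞)⁻¹ := by gcongr
    _ = _ := by rw [add_mul, one_mul]

/-- A finite weight function on `H\G` that dominates its convolution by a probability measure
is stationary. -/
lemma cosetConv_eq_of_le {G : Type*} [Group G] (H : Subgroup G) {m : G → ℝ≥0∞}
    (hm : ∑' g : G, m g = 1) {ν : Quotient (QuotientGroup.rightRel H) → ℝ≥0∞}
    (hν : ∑' C, ν C ≠ ⊤) (hle : cosetConv H m ν ≤ ν) : cosetConv H m ν = ν := by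
  refine hle.antisymm fun C => ?_
  by_contra! hlt
  have hfin : ∑' C, cosetConv H m ν C ≠ ⊤ := by rwa [tsum_cosetConv H hm]
  exact (ENNReal.tsum_lt_tsum hfin hle hlt).ne (tsum_cosetConv H hm ν)

/-- **Existence of a finite nonzero `m`-stationary measure on `H\G` supported on the
cosets of `K`, given that the convolution powers of `m` charge `HF` with positive
Cesàro density.** Here the right coset space `H\G` is
`Quotient (QuotientGroup.rightRel H)`. -/
theorem exists_stationary_of_liminf_pos {G : Type*} [Group G] [Countable G]
    (H K : Subgroup G)
    (m : G → ℝ≥0∞) (hm : ∑' g : G, m g = 1)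
    (hsupp : {g : G | m g ≠ 0} ⊆ (K : Set G))
    (F : Finset G)
    (hliminf : 0 < liminf (fun N : ℕ =>
      (∑ n ∈ Finset.Icc 1 N,
        ∑' g : ((H : Set G) * (F : Set G) : Set G), convPow m n (g : G)) / (N : ℝ≥0∞))
      atTop) :
    ∃ μ : Quotient (QuotientGroup.rightRel H) → ℝ≥0∞,
      0 < ∑' C, μ C ∧ ∑' C, μ C < ⊤ ∧
      (∀ x : G, μ (Quotient.mk (QuotientGroup.rightRel H) x)
        = ∑' g : G, μ (Quotient.mk (QuotientGroup.rightRel H) (x * g⁻¹)) * m g) ∧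
      (∀ g : G, g ∉ (H : Set G) * (K : Set G) →
        μ (Quotient.mk (QuotientGroup.rightRel H) g) = 0) := by
  let U : Ultrafilter ℕ := hyperfilter ℕ
  have hU : (U : Filter ℕ) ≤ atTop := Nat.hyperfilter_le_atTop
  have hlim : ∀ C, ∃ a, Tendsto (fun N => cosetCesaro H m N C) U (nhds a) := fun C =>
    ⟨_, (U.map fun N => cosetCesaro H m N C).le_nhds_lim⟩
  choose ν hν using hlim
  have hmass : ∑' C, ν C ≤ 1 := by
    rw [ENNReal.tsum_eq_iSup_sum]
    refine iSup_le fun s => le_of_tendsto (tendsto_finsetSum s fun C _ => hν C) ?_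
    exact .of_forall fun N => (ENNReal.sum_le_tsum s).trans (tsum_cosetCesaro_le H hm N)
  have hfin : ∑' C, ν C < ⊤ := hmass.trans_lt ENNReal.one_lt_top
  have hm_top : ∀ g, m g ≠ ⊤ := ENNReal.ne_top_of_tsum_ne_top (by simp [hm])
  have hle : cosetConv H m ν ≤ ν := by
    intro C
    unfold cosetConv
    rw [ENNReal.tsum_eq_iSup_sum]
    refine iSup_le fun s => ?_
    have hright : Tendsto (fun N : ℕ => cosetCesaro H m N C + (N : ℝ≥0∞)⁻¹) U (nhds (ν C)) := by
      simpa using (hν C).add (ENNReal.tendsto_inv_nat_nhds_zero.mono_left hU)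
    refine le_of_tendsto_of_tendsto' (tendsto_finsetSum s fun g _ =>
      ENNReal.Tendsto.mul_const (hν (rightCosetTranslate H g C)) (Or.inr (hm_top g))) hright
      fun N => ?_
    exact (ENNReal.sum_le_tsum s).trans (cosetConv_cosetCesaro_le H hm N C)
  refine ⟨ν, ?_, hfin, ?_, ?_⟩
  · let S := F.image (Quotient.mk (QuotientGroup.rightRel H))
    have hS : Tendsto (fun N => ∑ C ∈ S, cosetCesaro H m N C) U (nhds (∑ C ∈ S, ν C)) :=
      tendsto_finsetSum S fun C _ => hν C
    refine hliminf.trans_le (le_trans ?_ (ENNReal.sum_le_tsum S))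
    rw [← hS.liminf_eq]
    refine (liminf_le_liminf_of_le hU).trans (liminf_le_liminf (.of_forall fun N => ?_))
    simp only [cosetCesaro, div_eq_mul_inv]
    rw [← Finset.sum_mul, Finset.sum_comm]
    gcongr with n
    exact tsum_convPow_mul_le H m F n
  · intro x
    exact (congrFun (cosetConv_eq_of_le H hm hfin.ne hle) (Quotient.mk _ x)).symm
  · intro g hg
    refine tendsto_nhds_unique (hν (Quotient.mk _ g)) ?_
    simp [cosetCesaro, cosetPow_mk_eq_zero H hsupp _ hg]
end

section
/- Let k ≥ 1 be an integer, δ ≥ 0, and let I₀ ⊆ {1, 2, 3, …} satisfy liminf_{N→+∞} (1/N)·#(I₀ ∩ [1,N]) ≥ 1 − δ. Let I ⊆ I₀ be a maximal k-separated subset of I₀ (i.e., |n − m| ≥ k for all distinct n, m ∈ I, and I is maximal among subsets of I₀ with this property), and suppose I is infinite, enumerated I = {n₁ < n₂ < n₃ < …}. Then limsup_{N→+∞} (1/N)·Σ_{j : n_{j+1} ≤ N and n_{j+1} − n_j ≥ 2k} (n_{j+1} − n_j − 2k + 1) ≤ δ. -/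
open Filter

/-- In a gap of a maximal `k`-separated subset of `I₀`, the points at distance at least `k`
from both ends are not in `I₀`. -/
lemma notMem_of_mem_gap {k : ℕ} (hk : 1 ≤ k) {I₀ I : Set ℕ} (hII₀ : I ⊆ I₀)
    (hsep : ∀ m ∈ I, ∀ n ∈ I, m ≠ n → (k : ℤ) ≤ |(m : ℤ) - (n : ℤ)|)
    (hmax : ∀ J : Set ℕ, I ⊆ J → J ⊆ I₀ →
      (∀ m ∈ J, ∀ n ∈ J, m ≠ n → (k : ℤ) ≤ |(m : ℤ) - (n : ℤ)|) → J = I)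
    {e : ℕ → ℕ} (he : StrictMono e) (hrange : Set.range e = I) {j x : ℕ}
    (hx : e j + k ≤ x) (hx' : x + k ≤ e (j + 1)) : x ∉ I₀ := by
  intro hx₀
  have hfar : ∀ m ∈ I, m + k ≤ x ∨ x + k ≤ m := by
    rw [← hrange]
    rintro _ ⟨i, rfl⟩
    rcases Nat.lt_or_ge j i with h | h
    · have := he.monotone (Nat.succ_le_of_lt h)
      simp only [Nat.succ_eq_add_one] at this
      omega
    · have := he.monotone h
      omega
  have hJ : insert x I = I := by
    refine hmax _ (Set.subset_insert x I) (Set.insert_subset hx₀ hII₀) ?_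
    rintro m (rfl | hm) n (rfl | hn) hmn
    · exact absurd rfl hmn
    · rw [le_abs]
      have := hfar n hn
      omega
    · rw [le_abs]
      have := hfar m hm
      omega
    · exact hsep m hm n hn hmn
  have := hfar x (hJ ▸ Set.mem_insert x I)
  omega

/-- If the middle parts of all gaps of `e` avoid `I₀`, then their total length up to `N` plus the
number of elements of `I₀` up to `N` is at most `N`. -/
lemma sum_gaps_add_card_le {k : ℕ} (hk : 1 ≤ k) {I₀ : Set ℕ} {e : ℕ → ℕ} (he : StrictMono e)
    (hgap : ∀ j x, e j + k ≤ x → x + k ≤ e (j + 1) → x ∉ I₀) (N : ℕ) :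
    (∑ j ∈ Finset.range N, if e (j + 1) ≤ N ∧ 2 * k ≤ e (j + 1) - e j
      then e (j + 1) - e j - 2 * k + 1 else 0) +
      Nat.card {n : ℕ | n ∈ I₀ ∧ 1 ≤ n ∧ n ≤ N} ≤ N := by
  classical
  set G : Finset ℕ := (Finset.range N).filter
    (fun j => e (j + 1) ≤ N ∧ 2 * k ≤ e (j + 1) - e j) with hG
  set A : Finset ℕ := (Finset.Icc 1 N).filter (· ∈ I₀) with hA
  set B : Finset ℕ := G.biUnion fun j => Finset.Icc (e j + k) (e (j + 1) - k) with hB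
  have hcardA : Nat.card {n : ℕ | n ∈ I₀ ∧ 1 ≤ n ∧ n ≤ N} = A.card := by
    rw [← Set.ncard_coe_finset, ← Nat.card_coe_set_eq]
    congr 2
    ext n
    simp [hA, and_comm]
  have hcardB : (∑ j ∈ Finset.range N, if e (j + 1) ≤ N ∧ 2 * k ≤ e (j + 1) - e j
      then e (j + 1) - e j - 2 * k + 1 else 0) = B.card := by
    rw [← Finset.sum_filter, hB, Finset.card_biUnion]
    · refine Finset.sum_congr rfl fun j hj => ?_
      have hj := (Finset.mem_filter.1 hj).2
      rw [Nat.card_Icc]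
      omega
    · have hlt : ∀ i j, i < j → Disjoint (Finset.Icc (e i + k) (e (i + 1) - k))
          (Finset.Icc (e j + k) (e (j + 1) - k)) := by
        intro i j hij
        rw [Finset.disjoint_left]
        intro x hx hx'
        have := he.monotone (show i + 1 ≤ j from hij)
        simp only [Finset.mem_Icc] at hx hx'
        omega
      intro i _ j _ hij
      rcases lt_or_gt_of_ne hij with h | h
      · exact hlt i j h
      · exact (hlt j i h).symm
  have hBmem : ∀ x ∈ B, x ∉ I₀ ∧ 1 ≤ x ∧ x ≤ N := by
    intro x hx
    simp only [hB, hG, Finset.mem_biUnion, Finset.mem_filter, Finset.mem_Icc] at hx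
    obtain ⟨j, ⟨_, hjN, hjk⟩, h₁, h₂⟩ := hx
    exact ⟨hgap j x h₁ (by omega), by omega, by omega⟩
  have hdisj : Disjoint B A := by
    rw [Finset.disjoint_left]
    intro x hxB hxA
    exact (hBmem x hxB).1 (Finset.mem_filter.1 hxA).2
  rw [hcardA, hcardB, ← Finset.card_union_of_disjoint hdisj]
  calc (B ∪ A).card ≤ (Finset.Icc 1 N).card := by
        refine Finset.card_le_card (Finset.union_subset ?_ (Finset.filter_subset _ _))
        exact fun x hx => Finset.mem_Icc.2 (hBmem x hx).2
    _ = N := by simp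

/-- **Gap-density bound for maximal `k`-separated subsets.** If `I₀` has lower density
at least `1 − δ` in the positive integers and `I = {n₁ < n₂ < ⋯} ⊆ I₀` is an infinite
maximal `k`-separated subset, then
`limsup_N (1/N) Σ_{j : n_{j+1} ≤ N, n_{j+1} − n_j ≥ 2k} (n_{j+1} − n_j − 2k + 1) ≤ δ`. -/
theorem maximal_separated_gap_bound (k : ℕ) (hk : 1 ≤ k) (δ : ℝ) (hδ : 0 ≤ δ)
    (I₀ : Set ℕ) (hpos : ∀ n ∈ I₀, 1 ≤ n)
    (hdens : 1 - δ ≤ liminf (fun N : ℕ =>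
      (Nat.card {n : ℕ | n ∈ I₀ ∧ 1 ≤ n ∧ n ≤ N} : ℝ) / N) atTop)
    (I : Set ℕ) (hII₀ : I ⊆ I₀)
    (hsep : ∀ m ∈ I, ∀ n ∈ I, m ≠ n → (k : ℤ) ≤ |(m : ℤ) - (n : ℤ)|)
    (hmax : ∀ J : Set ℕ, I ⊆ J → J ⊆ I₀ →
      (∀ m ∈ J, ∀ n ∈ J, m ≠ n → (k : ℤ) ≤ |(m : ℤ) - (n : ℤ)|) → J = I)
    (e : ℕ → ℕ) (he : StrictMono e) (hrange : Set.range e = I) :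
    limsup (fun N : ℕ => (∑ j ∈ Finset.range N,
      if e (j + 1) ≤ N ∧ 2 * k ≤ e (j + 1) - e j
      then ((e (j + 1) - e j - 2 * k + 1 : ℕ) : ℝ) else 0) / N) atTop ≤ δ := by
  have hle : ∀ N : ℕ, (∑ j ∈ Finset.range N,
      if e (j + 1) ≤ N ∧ 2 * k ≤ e (j + 1) - e j
      then ((e (j + 1) - e j - 2 * k + 1 : ℕ) : ℝ) else 0) +
      (Nat.card {n : ℕ | n ∈ I₀ ∧ 1 ≤ n ∧ n ≤ N} : ℝ) ≤ N := fun N => by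
    have h := sum_gaps_add_card_le hk he
      (fun _ _ => notMem_of_mem_gap hk hII₀ hsep hmax he hrange) N
    have h' : (((∑ j ∈ Finset.range N, if e (j + 1) ≤ N ∧ 2 * k ≤ e (j + 1) - e j
      then e (j + 1) - e j - 2 * k + 1 else 0) +
      Nat.card {n : ℕ | n ∈ I₀ ∧ 1 ≤ n ∧ n ≤ N} : ℕ) : ℝ) ≤ N := Nat.cast_le.2 h
    rw [Nat.cast_add, Nat.cast_sum] at h'
    simpa only [Nat.cast_ite, Nat.cast_zero] using h'
  refine le_of_forall_pos_le_add fun ε hε => ?_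
  have hev := eventually_lt_of_lt_liminf (lt_of_lt_of_le (by linarith : 1 - δ - ε < 1 - δ) hdens)
    (isBoundedUnder_of ⟨0, fun N => by positivity⟩)
  refine limsup_le_of_le (isCoboundedUnder_le_of_le atTop (x := 0) fun N => ?_) ?_
  · exact div_nonneg (Finset.sum_nonneg fun j _ => by split_ifs <;> positivity) N.cast_nonneg
  · filter_upwards [hev, eventually_gt_atTop 0] with N hN hN₀
    have hN' : (0 : ℝ) < N := Nat.cast_pos.2 hN₀
    rw [lt_div_iff₀ hN'] at hN
    rw [div_le_iff₀ hN']
    linarith [hle N]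
end

section
/- Let G be a finitely generated group acting by homeomorphisms on a compact metrizable space Y, and let H ◁ G be a normal subgroup with G/H isomorphic to ℤ^k, where k ∈ {1,2}. Fix a finite generating set of G and let |·| denote the associated word length on G. Suppose m is a symmetric probability measure on G whose support generates G as a group, m has finite k-th moment (Σ_{g∈G} |g|^k·m(g) < +∞), and ν is an m-stationary Borel probability measure on Y. Then there exists a symmetric probability measure m' on G supported in H, whose support generates H as a group, such that m' * ν = ν. -/
open MeasureTheory
open scoped ENNReal

/-- The word length of `g` with respect to the generating set `S`: the least `n`
such that `g` is a product of `n` elements of `S ∪ S⁻¹`. -/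
noncomputable def wordLength {G : Type*} [Group G] (S : Finset G) (g : G) : ℕ :=
  sInf {n : ℕ | ∃ l : List G, (∀ x ∈ l, x ∈ S ∨ x⁻¹ ∈ S) ∧ l.length = n ∧ l.prod = g}

lemma two_mul_sq_div_le_energy {G V : Type*} [Group G] [AddCommGroup V] (m : G → ℝ≥0∞)
    (hm : ∑' g, m g = 1) (hsym : ∀ g, m g = m g⁻¹) (φ : G → V) (hφ : ∀ g, φ g⁻¹ = -φ g)
    (f : V → ℝ) (hf : ∑' x, ENNReal.ofReal (f x ^ 2) ≠ ⊤) (v : V → ℝ) (hv : ∀ x, 0 < v x)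
    (q : ℝ≥0∞) (hq : ∑' g, m g * ENNReal.ofReal (v (φ g)) + q ≤ ENNReal.ofReal (v 0))
    (hsup : ∀ x, ∑' g, m g * ENNReal.ofReal (v (x + φ g)) ≤ ENNReal.ofReal (v x)) :
    2 * (ENNReal.ofReal (f 0 ^ 2 / v 0) * q) ≤
      ∑' g, m g * ∑' x, ENNReal.ofReal ((f (x + φ g) - f x) ^ 2) := by
  classical
  set I := ∑' x, ENNReal.ofReal (f x ^ 2) with hI
  set E := ∑' g, m g * ∑' x, ENNReal.ofReal ((f (x + φ g) - f x) ^ 2) with hE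
  set Q := ENNReal.ofReal (f 0 ^ 2 / v 0) * q with hQ
  set J := ∑' g, m g * ∑' x, ENNReal.ofReal (f x ^ 2 / v x * v (x + φ g)) with hJ
  have hsplit : ∀ x y, ENNReal.ofReal (f x ^ 2 / v x * v y) =
      ENNReal.ofReal (f x ^ 2 / v x) * ENNReal.ofReal (v y) := fun x y =>
    ENNReal.ofReal_mul (div_nonneg (sq_nonneg _) (hv x).le)
  have hdiag : ∀ x, ENNReal.ofReal (f x ^ 2 / v x) * ENNReal.ofReal (v x) =
      ENNReal.ofReal (f x ^ 2) := fun x => by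
    rw [← hsplit, div_mul_cancel₀ _ (hv x).ne']
  have h1 : J + Q ≤ I := by
    have hJ' : J = ∑' x, ENNReal.ofReal (f x ^ 2 / v x) *
        ∑' g, m g * ENNReal.ofReal (v (x + φ g)) := by
      simp_rw [hJ, ← ENNReal.tsum_mul_left]
      rw [ENNReal.tsum_comm]
      refine tsum_congr fun x => tsum_congr fun g => ?_
      rw [hsplit]; ring
    have hQ' : Q = ∑' x : V, if x = 0 then Q else 0 := by rw [tsum_ite_eq]
    rw [hQ', hJ', ← ENNReal.tsum_add]
    refine ENNReal.tsum_le_tsum fun x => ?_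
    rw [← hdiag x]
    split_ifs with hx
    · subst hx
      rw [hQ, ← mul_add]
      gcongr
      simpa using hq
    · rw [add_zero]
      gcongr
      exact hsup x
  have hJ2 : ∑' g, m g * ∑' x, ENNReal.ofReal (f (x + φ g) ^ 2 / v (x + φ g) * v x) = J := by
    rw [hJ, ← (Equiv.inv G).tsum_eq]
    refine tsum_congr fun g => ?_
    simp only [Equiv.inv_apply]
    rw [← hsym, ← (Equiv.addRight (φ g)).tsum_eq]
    simp [hφ]
  have hI1 : ∀ g, ∑' x, ENNReal.ofReal (f (x + φ g) ^ 2) = I := fun g =>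
    (Equiv.addRight (φ g)).tsum_eq fun x => ENNReal.ofReal (f x ^ 2)
  have h2 : 2 * I ≤ E + 2 * J := by
    calc 2 * I = ∑' g, m g * ∑' x, (ENNReal.ofReal (f x ^ 2) + ENNReal.ofReal (f (x + φ g) ^ 2)) := by
          simp_rw [ENNReal.tsum_add, hI1, ← hI, ENNReal.tsum_mul_right, hm]
          ring
      _ ≤ ∑' g, m g * ∑' x, (ENNReal.ofReal ((f (x + φ g) - f x) ^ 2) +
            (ENNReal.ofReal (f x ^ 2 / v x * v (x + φ g)) +
            ENNReal.ofReal (f (x + φ g) ^ 2 / v (x + φ g) * v x))) := by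
          refine ENNReal.tsum_le_tsum fun g => mul_le_mul_right (ENNReal.tsum_le_tsum fun x => ?_) _
          have ha := hv x
          have hb := hv (x + φ g)
          rw [← ENNReal.ofReal_add (sq_nonneg (f x)) (sq_nonneg _),
            ← ENNReal.ofReal_add (p := f x ^ 2 / v x * v (x + φ g)) (by positivity) (by positivity),
            ← ENNReal.ofReal_add (by positivity) (by positivity)]
          apply ENNReal.ofReal_le_ofReal
          have key : f x ^ 2 / v x * v (x + φ g) + f (x + φ g) ^ 2 / v (x + φ g) * v x
              - 2 * (f x * f (x + φ g)) =
              (f x * v (x + φ g) - f (x + φ g) * v x) ^ 2 / (v x * v (x + φ g)) := by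
            field_simp
            ring
          have : 0 ≤ (f x * v (x + φ g) - f (x + φ g) * v x) ^ 2 / (v x * v (x + φ g)) := by
            positivity
          nlinarith
      _ = E + 2 * J := by
          simp_rw [ENNReal.tsum_add, mul_add, ENNReal.tsum_add]
          rw [hJ2, two_mul]
  have h3 : 2 * I + 2 * Q ≤ 2 * I + E := by
    calc 2 * I + 2 * Q ≤ E + 2 * J + 2 * Q := by gcongr
      _ = E + 2 * (J + Q) := by ring
      _ ≤ E + 2 * I := by gcongr
      _ = _ := add_comm _ _
  exact (ENNReal.add_le_add_iff_left (ENNReal.mul_ne_top (by simp) hf)).1 h3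

/-- The transition operator of the walk on `V` with increments `φ g`, killed on entering `0`. -/
noncomputable def killedOp {G V : Type*} [AddCommGroup V] (m : G → ℝ≥0∞) (φ : G → V)
    (b : V → ℝ≥0∞) (x : V) : ℝ≥0∞ :=
  open Classical in ∑' g, m g * if x + φ g = 0 then 0 else b (x + φ g)

lemma killedOp_mono {G V : Type*} [AddCommGroup V] (m : G → ℝ≥0∞) (φ : G → V) :
    Monotone (killedOp m φ) := by
  intro b c h x
  unfold killedOp
  gcongr with g
  split_ifs
  · exact le_rfl
  · exact h _

lemma antitone_iterate_killedOp {G V : Type*} [AddCommGroup V] (m : G → ℝ≥0∞)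
    (hm : ∑' g, m g = 1) (φ : G → V) : Antitone fun n => (killedOp m φ)^[n] 1 := by
  refine (killedOp_mono m φ).antitone_iterate_of_map_le fun x => ?_
  calc killedOp m φ 1 x ≤ ∑' g, m g * 1 := by
        unfold killedOp
        gcongr
        split_ifs <;> simp
    _ = 1 := by simpa using hm

lemma killedOp_iInf {G V : Type*} [AddCommGroup V] (m : G → ℝ≥0∞)
    (hm : ∑' g, m g = 1) (φ : G → V) (b : ℕ → V → ℝ≥0∞) (hb : Antitone b) (hb1 : b 0 ≤ 1) (x : V) :
    killedOp m φ (fun y => ⨅ n, b n y) x = ⨅ n, killedOp m φ (b n) x := by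
  classical
  let _ : MeasurableSpace G := ⊤
  have hmt : ∀ g, m g ≠ ⊤ := fun g => ENNReal.ne_top_of_tsum_ne_top (by simp [hm]) g
  simp_rw [killedOp, ← lintegral_count]
  rw [← lintegral_iInf (fun n => measurable_from_top)]
  · congr 1
    ext g
    rw [← ENNReal.mul_iInf (by simp [hmt])]
    congr 1
    split_ifs <;> simp
  · intro i j hij g
    dsimp only
    gcongr
    split_ifs
    · exact le_rfl
    · exact hb hij _
  · rw [lintegral_count]
    refine ne_top_of_le_ne_top (b := 1) (by simp) (hm ▸ ENNReal.tsum_le_tsum fun g => ?_)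
    refine mul_le_of_le_one_right' ?_
    split_ifs
    · simp
    · exact hb1 _

lemma iterate_killedOp_tendsto {G V : Type*} [Group G] [AddCommGroup V] (m : G → ℝ≥0∞)
    (hm : ∑' g, m g = 1) (hsym : ∀ g, m g = m g⁻¹) (φ : G → V) (hφ : ∀ g, φ g⁻¹ = -φ g)
    (hE : ∀ ε : ℝ≥0∞, 0 < ε → ∃ f : V → ℝ, f 0 = 1 ∧ ∑' x, ENNReal.ofReal (f x ^ 2) ≠ ⊤ ∧
      ∑' g, m g * ∑' x, ENNReal.ofReal ((f (x + φ g) - f x) ^ 2) ≤ ε) :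
    Filter.Tendsto (fun n => (killedOp m φ)^[n] 1 0) Filter.atTop (nhds 0) := by
  classical
  have hanti := antitone_iterate_killedOp m hm φ
  set a : V → ℝ≥0∞ := fun x => ⨅ n, (killedOp m φ)^[n] 1 x with ha
  have hfix : ∀ x, killedOp m φ a x = a x := by
    intro x
    rw [ha, killedOp_iInf m hm φ _ hanti (le_refl _)]
    simp_rw [← Function.iterate_succ_apply' (killedOp m φ)]
    apply le_antisymm
    · exact le_iInf fun n => (iInf_le _ n).trans (hanti n.le_succ x)
    · exact le_iInf fun n => iInf_le _ (n + 1)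
  have ha1 : ∀ x, a x ≤ 1 := fun x => iInf_le (fun n => (killedOp m φ)^[n] 1 x) 0
  have hat : ∀ x, a x ≠ ⊤ := fun x => ne_top_of_le_ne_top (by simp) (ha1 x)
  have htend : Filter.Tendsto (fun n => (killedOp m φ)^[n] 1 0) Filter.atTop (nhds (a 0)) :=
    tendsto_atTop_iInf fun i j h => hanti h 0
  suffices a 0 = 0 by rwa [this] at htend
  let s : V → ℝ≥0∞ := fun x => if x = 0 then 0 else a x
  have hs1 : ∀ x, s x ≤ 1 := fun x => by
    dsimp only [s]; split_ifs
    · simp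
    · exact ha1 x
  have hst : ∀ x, s x ≠ ⊤ := fun x => ne_top_of_le_ne_top (by simp) (hs1 x)
  let v : V → ℝ := fun x => 2 - (s x).toReal
  have hv : ∀ x, 0 < v x := fun x => by
    have := ENNReal.toReal_mono (by simp) (hs1 x)
    simp only [ENNReal.toReal_one] at this
    dsimp only [v]; linarith
  have hvs : ∀ x, ENNReal.ofReal (v x) + s x = 2 := fun x => by
    rw [← ENNReal.ofReal_toReal (hst x), ← ENNReal.ofReal_add (hv x).le (by simp)]
    simp [v]
  have hPv : ∀ x, ∑' g, m g * ENNReal.ofReal (v (x + φ g)) + a x = 2 := fun x => by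
    rw [← hfix x, killedOp, ← ENNReal.tsum_add]
    simp_rw [← mul_add]
    have : ∀ g, m g * (ENNReal.ofReal (v (x + φ g)) + if x + φ g = 0 then 0 else a (x + φ g)) =
      m g * 2 := fun g => by rw [← hvs (x + φ g)]
    rw [tsum_congr this, ENNReal.tsum_mul_right, hm, one_mul]
  have h0 : ENNReal.ofReal (v 0) = 2 := by simpa [s] using hvs 0
  have hbound : ∀ ε : ℝ≥0∞, 0 < ε → a 0 ≤ ε := by
    intro ε hε
    obtain ⟨f, hf0, hf, hfE⟩ := hE ε hε
    have := two_mul_sq_div_le_energy m hm hsym φ hφ f hf v hv (a 0)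
      (by have := hPv 0; simp only [zero_add] at this; rw [this, h0]) (fun x => by
        have h1 := hPv x
        rw [← hvs x] at h1
        by_cases hx : x = 0
        · subst hx
          rw [h0, ← hPv 0]; exact le_self_add
        · simp only [s, hx, if_false] at h1
          exact ((ENNReal.add_left_inj (hat x)).1 h1).le)
    refine le_trans (le_of_eq ?_) (this.trans hfE)
    have hv0 : v 0 = 2 := by simp [v, s]
    rw [hf0, hv0, ← mul_assoc]
    have : (2 : ℝ≥0∞) * ENNReal.ofReal (1 ^ 2 / 2) = 1 := by
      rw [← ENNReal.ofReal_ofNat, ← ENNReal.ofReal_mul (by norm_num)]; norm_num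
    rw [this, one_mul]
  exact le_antisymm (le_of_forall_gt_imp_ge_of_dense fun ε hε => hbound ε hε) (by simp)

/-- The weight of paths of length `n + 1` from `x` to `y`, for the right random walk driven by `m`,
whose interior vertices avoid `H`. -/
noncomputable def tabooWeight {G : Type*} [Group G] (H : Subgroup G) (m : G → ℝ≥0∞) :
    ℕ → G → G → ℝ≥0∞
  | 0, x, y => m (x⁻¹ * y)
  | n + 1, x, y => ∑' z : ((H : Set G)ᶜ : Set G), tabooWeight H m n x z * m ((z : G)⁻¹ * y)

section
variable {G : Type*} [Group G] (H : Subgroup G) (m : G → ℝ≥0∞)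

lemma tabooWeight_succ' (n : ℕ) (x y : G) : tabooWeight H m (n + 1) x y =
    ∑' z : ((H : Set G)ᶜ : Set G), m (x⁻¹ * z) * tabooWeight H m n z y := by
  induction n generalizing x y with
  | zero => rfl
  | succ n ih =>
    conv_lhs => rw [tabooWeight]; simp only [ih]
    conv_rhs => simp only [tabooWeight]
    simp_rw [← ENNReal.tsum_mul_left, ← ENNReal.tsum_mul_right]
    rw [ENNReal.tsum_comm]
    simp_rw [mul_assoc]

lemma tabooWeight_symm (hsym : ∀ g, m g = m g⁻¹) (n : ℕ) (x y : G) :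
    tabooWeight H m n x y = tabooWeight H m n y x := by
  induction n generalizing x y with
  | zero => simp only [tabooWeight]; rw [hsym]; simp
  | succ n ih =>
    rw [tabooWeight_succ', tabooWeight]
    refine tsum_congr fun z => ?_
    rw [ih z y, hsym, mul_comm]; simp

lemma tabooWeight_mul_left {h : G} (hh : h ∈ H) (n : ℕ) (x y : G) :
    tabooWeight H m n (h * x) (h * y) = tabooWeight H m n x y := by
  induction n generalizing x y with
  | zero => simp [tabooWeight, mul_assoc]
  | succ n ih =>
    let e : ((H : Set G)ᶜ : Set G) ≃ ((H : Set G)ᶜ : Set G) :=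
      (Equiv.mulLeft h).subtypeEquiv fun a => by
        simp [Subgroup.mul_mem_cancel_left H hh]
    rw [tabooWeight, tabooWeight, ← e.tsum_eq]
    refine tsum_congr fun z => ?_
    have : ((e z : ((H : Set G)ᶜ : Set G)) : G) = h * z := rfl
    rw [this, ih]
    simp [mul_assoc]

lemma tsum_tabooWeight_succ (n : ℕ) (β : G → ℝ≥0∞) : ∑' y, tabooWeight H m (n + 1) 1 y * β y =
    ∑' x : ((H : Set G)ᶜ : Set G), tabooWeight H m n 1 x * ∑' g, m g * β (x * g) := by
  simp_rw [tabooWeight, ← ENNReal.tsum_mul_right]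
  rw [ENNReal.tsum_comm]
  refine tsum_congr fun x => ?_
  rw [← (Equiv.mulLeft (x : G)).tsum_eq, ← ENNReal.tsum_mul_left]
  simp [mul_assoc]

lemma tsum_eq_add_compl (β : G → ℝ≥0∞) :
    ∑' y, β y = ∑' y : H, β y + ∑' y : ((H : Set G)ᶜ : Set G), β y :=
  (ENNReal.summable.tsum_add_tsum_compl (s := (H : Set G)) ENNReal.summable).symm

/-- The first-return distribution to `H` of the right random walk driven by `m`. -/
noncomputable def hittingWeight (g : G) : ℝ≥0∞ :=
  open Classical in if g ∈ H then ∑' n, tabooWeight H m n 1 g else 0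

lemma hittingWeight_inv (hsym : ∀ g, m g = m g⁻¹) (g : G) :
    hittingWeight H m g = hittingWeight H m g⁻¹ := by
  by_cases hg : g ∈ H
  · simp only [hittingWeight, hg, inv_mem hg, if_true]
    refine tsum_congr fun n => ?_
    rw [tabooWeight_symm H m hsym, ← tabooWeight_mul_left H m (inv_mem hg)]
    simp
  · simp [hittingWeight, hg]

lemma hittingWeight_ne_zero_iff (g : G) :
    hittingWeight H m g ≠ 0 ↔ g ∈ H ∧ ∃ n, tabooWeight H m n 1 g ≠ 0 := by
  unfold hittingWeight
  split_ifs with hg <;> simp [hg, ENNReal.tsum_eq_zero]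

lemma closure_hittingWeight_support (hsym : ∀ g, m g = m g⁻¹)
    (hgen : Subgroup.closure {g : G | m g ≠ 0} = ⊤) :
    Subgroup.closure {g : G | hittingWeight H m g ≠ 0} = H := by
  set K := Subgroup.closure {g : G | hittingWeight H m g ≠ 0} with hK
  have hKH : K ≤ H := (Subgroup.closure_le _).2 fun g hg =>
    ((hittingWeight_ne_zero_iff H m g).1 hg).1
  have hmem : ∀ κ ∈ K, ∀ x n, tabooWeight H m n 1 (κ⁻¹ * x) ≠ 0 → κ⁻¹ * x ∈ H → x ∈ K := by
    intro κ hκ x n hn hx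
    have : κ⁻¹ * x ∈ K := Subgroup.subset_closure
      ((hittingWeight_ne_zero_iff H m _).2 ⟨hx, n, hn⟩)
    exact (Subgroup.mul_mem_cancel_left K (inv_mem hκ)).1 this
  have hstep : ∀ x g, m g ≠ 0 → (x ∈ K ∨ ∃ κ ∈ K, ∃ n, tabooWeight H m n 1 (κ⁻¹ * x) ≠ 0) →
      (x * g ∈ K ∨ ∃ κ ∈ K, ∃ n, tabooWeight H m n 1 (κ⁻¹ * (x * g)) ≠ 0) := by
    intro x g hg hx
    by_cases hxK : x ∈ K
    · exact Or.inr ⟨x, hxK, 0, by simpa [tabooWeight] using hg⟩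
    · obtain ⟨κ, hκ, n, hn⟩ := hx.resolve_left hxK
      have hxH : κ⁻¹ * x ∉ H := fun h => hxK (hmem κ hκ x n hn h)
      refine Or.inr ⟨κ, hκ, n + 1, ?_⟩
      rw [tabooWeight, Ne, ENNReal.tsum_eq_zero]
      push Not
      refine ⟨⟨κ⁻¹ * x, hxH⟩, ?_⟩
      simpa [mul_assoc, hn] using hg
  have hreach : ∀ x, x ∈ K ∨ ∃ κ ∈ K, ∃ n, tabooWeight H m n 1 (κ⁻¹ * x) ≠ 0 := by
    intro x
    have hx : x ∈ Subgroup.closure {g : G | m g ≠ 0} := by rw [hgen]; trivial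
    induction hx using Subgroup.closure_induction_right with
    | one => exact Or.inl (one_mem K)
    | mul_right x _ y hy ih => exact hstep x y hy ih
    | mul_inv_cancel x _ y hy ih => exact hstep x y⁻¹ (by rw [← hsym]; exact hy) ih
  refine le_antisymm hKH fun h hh => ?_
  rcases hreach h with hK' | ⟨κ, hκ, n, hn⟩
  · exact hK'
  · exact hmem κ hκ h n hn (mul_mem (inv_mem (hKH hκ)) hh)

lemma tsum_hittingWeight_mul (hrec : Filter.Tendsto
      (fun n => ∑' y : ((H : Set G)ᶜ : Set G), tabooWeight H m n 1 y) Filter.atTop (nhds 0))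
    (β : G → ℝ≥0∞) (hβ1 : ∀ g, β g ≤ 1) (hβ : ∀ x, ∑' g, m g * β (x * g) = β x) :
    ∑' g, hittingWeight H m g * β g = β 1 := by
  have hsum : ∀ n, ∑ i ∈ Finset.range (n + 1), ∑' h : H, tabooWeight H m i 1 h * β h +
      ∑' y : ((H : Set G)ᶜ : Set G), tabooWeight H m n 1 y * β y = β 1 := by
    intro n
    induction n with
    | zero =>
      rw [Finset.sum_range_one, ← tsum_eq_add_compl H fun y => tabooWeight H m 0 1 y * β y, ← hβ 1]
      simp [tabooWeight]
    | succ n ih =>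
      rw [Finset.sum_range_succ, add_assoc,
        ← tsum_eq_add_compl H fun y => tabooWeight H m (n + 1) 1 y * β y,
        tsum_tabooWeight_succ]
      simp_rw [hβ]
      exact ih
  have hzero : Filter.Tendsto (fun n => ∑' y : ((H : Set G)ᶜ : Set G),
      tabooWeight H m n 1 y * β y) Filter.atTop (nhds 0) :=
    tendsto_of_tendsto_of_tendsto_of_le_of_le tendsto_const_nhds hrec (fun _ => zero_le)
      fun n => ENNReal.tsum_le_tsum fun y => mul_le_of_le_one_right' (hβ1 _)
  have hlim := ((ENNReal.summable.hasSum (f := fun i => ∑' h : H,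
    tabooWeight H m i 1 h * β h)).tendsto_sum_nat.comp (Filter.tendsto_add_atTop_nat 1)).add hzero
  simp only [Function.comp_def, hsum, add_zero] at hlim
  rw [tsum_eq_add_compl H fun g => hittingWeight H m g * β g]
  have h1 : ∑' y : ((H : Set G)ᶜ : Set G), hittingWeight H m y * β y = 0 := by
    rw [ENNReal.tsum_eq_zero]
    intro y
    have : (y : G) ∉ H := y.2
    simp [hittingWeight, this]
  have h2 : ∑' y : H, hittingWeight H m y * β y =
      ∑' i, ∑' h : H, tabooWeight H m i 1 h * β h := by
    rw [ENNReal.tsum_comm]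
    refine tsum_congr fun h => ?_
    simp [hittingWeight, ENNReal.tsum_mul_right]
  rw [h1, h2, add_zero]
  exact tendsto_nhds_unique hlim tendsto_const_nhds
end

/-- The tent function of radius `R` on `ℤᵏ`. -/
noncomputable def tent {k : ℕ} (R : ℝ) (x : Fin k → ℤ) : ℝ := max 0 (1 - ‖x‖ / R)

/-- The indicator of the set where a function supported in the open ball of radius `R`, or its
translate by `z`, may be nonzero. -/
noncomputable def nearBall {k : ℕ} (R : ℕ) (z x : Fin k → ℤ) : ℝ≥0∞ :=
  open Classical in if ‖x‖ < R ∨ ‖x + z‖ < R then 1 else 0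

lemma tsum_ball_le {k : ℕ} (R : ℕ) [DecidablePred fun x : Fin k → ℤ => ‖x‖ < R] :
    ∑' x : Fin k → ℤ, (if ‖x‖ < R then 1 else 0 : ℝ≥0∞) ≤ (2 * R) ^ k := by
  let s : Finset (Fin k → ℤ) := Fintype.piFinset fun _ => Finset.Ico (-R : ℤ) R
  have hs : s.card = (2 * R) ^ k := by
    simp only [s, Fintype.card_piFinset, Int.card_Ico, Finset.prod_const, Finset.card_univ,
      Fintype.card_fin]
    congr 1
    omega
  have hout : ∀ x ∉ s, (if ‖x‖ < R then 1 else 0 : ℝ≥0∞) = 0 := by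
    intro x hx
    rw [if_neg]
    intro hlt
    apply hx
    rw [Fintype.mem_piFinset]
    intro i
    have h1 := (norm_le_pi_norm x i).trans_lt hlt
    rw [Int.norm_eq_abs] at h1
    have h2 : |x i| < (R : ℤ) := by exact_mod_cast h1
    rw [abs_lt] at h2
    exact Finset.mem_Ico.2 ⟨h2.1.le, h2.2⟩
  rw [tsum_eq_sum hout]
  calc ∑ x ∈ s, (if ‖x‖ < R then 1 else 0 : ℝ≥0∞) ≤ ∑ x ∈ s, 1 :=
        Finset.sum_le_sum fun x _ => by split_ifs <;> simp
    _ = (2 * R) ^ k := by simp [hs]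

lemma tsum_nearBall_le {k : ℕ} (R : ℕ) (z : Fin k → ℤ) :
    ∑' x, nearBall R z x ≤ 2 * (2 * R) ^ k := by
  classical
  calc ∑' x, nearBall R z x
      ≤ ∑' x : Fin k → ℤ, ((if ‖x‖ < R then 1 else 0) + if ‖x + z‖ < R then 1 else 0) := by
        refine ENNReal.tsum_le_tsum fun x => ?_
        unfold nearBall
        by_cases h1 : ‖x‖ < R <;> by_cases h2 : ‖x + z‖ < R <;> simp [h1, h2]
    _ = (∑' x : Fin k → ℤ, if ‖x‖ < R then 1 else 0) +
        ∑' x : Fin k → ℤ, if ‖x‖ < R then 1 else 0 := by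
        rw [ENNReal.tsum_add]
        congr 1
        exact (Equiv.addRight z).tsum_eq fun x : Fin k → ℤ => if ‖x‖ < R then (1 : ℝ≥0∞) else 0
    _ ≤ (2 * R) ^ k + (2 * R) ^ k := add_le_add (tsum_ball_le R) (tsum_ball_le R)
    _ = _ := (two_mul _).symm

lemma tent_zero {k : ℕ} (R : ℝ) : tent R (0 : Fin k → ℤ) = 1 := by simp [tent]

lemma tent_nonneg {k : ℕ} (R : ℝ) (x : Fin k → ℤ) : 0 ≤ tent R x := le_max_left _ _

lemma tent_le_one {k : ℕ} (R : ℕ) (x : Fin k → ℤ) : tent R x ≤ 1 :=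
  max_le zero_le_one (by have : 0 ≤ ‖x‖ / R := by positivity
                         linarith)

lemma tent_eq_zero {k : ℕ} {R : ℕ} (hR : 0 < R) {x : Fin k → ℤ} (hx : R ≤ ‖x‖) :
    tent R x = 0 := by
  have hR' : (0 : ℝ) < R := by exact_mod_cast hR
  exact max_eq_left (sub_nonpos.2 ((one_le_div hR').2 hx))

lemma ofReal_abs_tent_sub_le {k : ℕ} {R : ℕ} (hR : 0 < R) (z x : Fin k → ℤ) :
    ENNReal.ofReal |tent R (x + z) - tent R x| ≤
      ENNReal.ofReal (min 1 (‖z‖ / R)) * nearBall R z x := by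
  unfold nearBall
  split_ifs with h
  · rw [mul_one]
    refine ENNReal.ofReal_le_ofReal (le_min ?_ ?_)
    · rw [abs_le]
      have h1 := tent_nonneg R x
      have h2 := tent_nonneg R (x + z)
      have h3 := tent_le_one R x
      have h4 := tent_le_one R (x + z)
      constructor <;> linarith
    · have hR' : (0 : ℝ) < R := by exact_mod_cast hR
      refine (abs_max_sub_max_le_max _ _ _ _).trans (max_le (by simp; positivity) ?_)
      rw [sub_sub_sub_cancel_left, ← sub_div, abs_div, abs_of_pos hR']
      gcongr
      refine (abs_norm_sub_norm_le _ _).trans_eq ?_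
      rw [sub_add_cancel_left, norm_neg]
  · push Not at h
    rw [tent_eq_zero hR h.1, tent_eq_zero hR h.2]
    simp

lemma tsum_ofReal_sq_ne_top {k : ℕ} (R : ℕ) (f : (Fin k → ℤ) → ℝ) (hf0 : ∀ x, 0 ≤ f x)
    (hf1 : ∀ x, f x ≤ 1) (hf : ∀ x, R ≤ ‖x‖ → f x = 0) :
    ∑' x, ENNReal.ofReal (f x ^ 2) ≠ ⊤ := by
  classical
  refine ne_top_of_le_ne_top (b := (2 * R : ℝ≥0∞) ^ k) (by finiteness)
    ((ENNReal.tsum_le_tsum fun x => ?_).trans (tsum_ball_le R))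
  split_ifs with h
  · rw [ENNReal.ofReal_le_one]
    exact pow_le_one₀ (hf0 x) (hf1 x)
  · simp [hf x (not_lt.1 h)]

lemma exists_test_function_one {G : Type*} (m : G → ℝ≥0∞) (hm : ∀ g, m g ≠ ⊤)
    (φ : G → Fin 1 → ℤ)
    (hmom : ∑' g, m g * ENNReal.ofReal ‖φ g‖ ≠ ⊤) (ε : ℝ≥0∞) (hε : 0 < ε) :
    ∃ f : (Fin 1 → ℤ) → ℝ, f 0 = 1 ∧ ∑' x, ENNReal.ofReal (f x ^ 2) ≠ ⊤ ∧
      ∑' g, m g * ∑' x, ENNReal.ofReal ((f (x + φ g) - f x) ^ 2) ≤ ε := by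
  let _ : MeasurableSpace G := ⊤
  have hen : ∀ (n : ℕ) (z : Fin 1 → ℤ),
      ∑' x, ENNReal.ofReal ((tent (n + 1 : ℕ) (x + z) - tent (n + 1 : ℕ) x) ^ 2) ≤
        ENNReal.ofReal (4 * (n + 1 : ℕ) * min 1 (‖z‖ / (n + 1 : ℕ)) ^ 2) := by
    intro n z
    have hmin : 0 ≤ min 1 (‖z‖ / (n + 1 : ℕ)) := by positivity
    calc _ ≤ ∑' x, ENNReal.ofReal (min 1 (‖z‖ / (n + 1 : ℕ))) ^ 2 * nearBall (n + 1) z x := by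
          refine ENNReal.tsum_le_tsum fun x => ?_
          rw [← sq_abs, ENNReal.ofReal_pow (abs_nonneg _)]
          refine (pow_le_pow_left₀ zero_le
            (ofReal_abs_tent_sub_le n.succ_pos z x) 2).trans_eq ?_
          rw [mul_pow]
          congr 1
          unfold nearBall
          split_ifs <;> simp
      _ ≤ ENNReal.ofReal (min 1 (‖z‖ / (n + 1 : ℕ))) ^ 2 * (2 * (2 * (n + 1 : ℕ)) ^ 1) := by
          rw [ENNReal.tsum_mul_left]
          gcongr
          exact tsum_nearBall_le _ _
      _ = _ := by
          rw [← ENNReal.ofReal_pow hmin, ← ENNReal.ofReal_natCast (n + 1),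
            ← ENNReal.ofReal_ofNat 2, pow_one, ← ENNReal.ofReal_mul (by positivity),
            ← ENNReal.ofReal_mul (by positivity), ← ENNReal.ofReal_mul (by positivity)]
          congr 1
          ring
  have hlim : Filter.Tendsto (fun n : ℕ => ∫⁻ g, m g *
      ∑' x, ENNReal.ofReal ((tent (n + 1 : ℕ) (x + φ g) - tent (n + 1 : ℕ) x) ^ 2)
        ∂Measure.count) Filter.atTop (nhds (∫⁻ _ : G, 0 ∂Measure.count)) := by
    refine tendsto_lintegral_of_dominated_convergence
      (fun g => m g * ENNReal.ofReal (4 * ‖φ g‖)) (fun _ => measurable_from_top)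
      (fun n => Filter.Eventually.of_forall fun g => ?_) ?_
      (Filter.Eventually.of_forall fun g => ?_)
    · dsimp only
      gcongr
      refine (hen n (φ g)).trans (ENNReal.ofReal_le_ofReal ?_)
      have hn : (0 : ℝ) < (n + 1 : ℕ) := by positivity
      have h1 : min 1 (‖φ g‖ / (n + 1 : ℕ)) ≤ 1 := min_le_left _ _
      have h2 : min 1 (‖φ g‖ / (n + 1 : ℕ)) ≤ ‖φ g‖ / (n + 1 : ℕ) := min_le_right _ _
      have h3 : 0 ≤ min 1 (‖φ g‖ / (n + 1 : ℕ)) := by positivity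
      rw [le_div_iff₀ hn] at h2
      nlinarith [mul_le_mul_of_nonneg_left h1 (mul_nonneg h3 hn.le)]
    · rw [lintegral_count]
      simp_rw [ENNReal.ofReal_mul (show (0 : ℝ) ≤ 4 by norm_num), mul_left_comm (m _)]
      rw [ENNReal.tsum_mul_left]
      finiteness
    · have hb : Filter.Tendsto (fun n : ℕ => ENNReal.ofReal (4 * ‖φ g‖ ^ 2 / (n + 1 : ℕ)))
          Filter.atTop (nhds 0) := by
        rw [← ENNReal.ofReal_zero]
        exact ENNReal.tendsto_ofReal ((tendsto_const_div_atTop_nhds_zero_nat _).comp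
          (Filter.tendsto_add_atTop_nat 1))
      have hc := ENNReal.Tendsto.const_mul (a := m g) hb (Or.inr (hm g))
      rw [mul_zero] at hc
      refine tendsto_of_tendsto_of_tendsto_of_le_of_le tendsto_const_nhds hc
        (fun _ => zero_le) fun n => ?_
      dsimp only
      gcongr
      refine (hen n (φ g)).trans (ENNReal.ofReal_le_ofReal ?_)
      have hn : (0 : ℝ) < (n + 1 : ℕ) := by positivity
      have h3 : 0 ≤ min 1 (‖φ g‖ / (n + 1 : ℕ)) := by positivity
      calc 4 * ((n + 1 : ℕ) : ℝ) * min 1 (‖φ g‖ / (n + 1 : ℕ)) ^ 2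
          ≤ 4 * ((n + 1 : ℕ) : ℝ) * (‖φ g‖ / (n + 1 : ℕ)) ^ 2 := by
            gcongr
            exact min_le_right _ _
        _ = _ := by field_simp
  simp only [lintegral_count, lintegral_zero] at hlim
  obtain ⟨n, hn⟩ := (hlim.eventually (ge_mem_nhds hε)).exists
  exact ⟨tent (n + 1 : ℕ), tent_zero _,
    tsum_ofReal_sq_ne_top (n + 1) _ (tent_nonneg _) (tent_le_one _)
      (fun x hx => tent_eq_zero n.succ_pos hx), hn⟩

lemma tsum_dyadic_sq_le (z : Fin 2 → ℤ) (N : ℕ) :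
    ∑' x, (∑ j ∈ Finset.range N, ENNReal.ofReal (‖z‖ / 2 ^ j) * nearBall (2 ^ j) z x) ^ 2 ≤
      N * ENNReal.ofReal (24 * ‖z‖ ^ 2) := by
  have hcross : ∀ i j, ∑' x, (ENNReal.ofReal (‖z‖ / 2 ^ i) * nearBall (2 ^ i) z x) *
      (ENNReal.ofReal (‖z‖ / 2 ^ j) * nearBall (2 ^ j) z x) ≤
        ENNReal.ofReal (8 * ‖z‖ ^ 2 / 2 ^ j * 2 ^ i) := by
    intro i j
    calc _ ≤ ∑' x, ENNReal.ofReal (‖z‖ / 2 ^ i * (‖z‖ / 2 ^ j)) * nearBall (2 ^ i) z x := by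
          refine ENNReal.tsum_le_tsum fun x => ?_
          rw [ENNReal.ofReal_mul (by positivity), mul_mul_mul_comm]
          gcongr
          refine mul_le_of_le_one_right' ?_
          unfold nearBall
          split_ifs <;> simp
      _ ≤ ENNReal.ofReal (‖z‖ / 2 ^ i * (‖z‖ / 2 ^ j)) * (2 * (2 * (2 ^ i : ℕ)) ^ 2) := by
          rw [ENNReal.tsum_mul_left]
          gcongr
          exact tsum_nearBall_le _ _
      _ = _ := by
          rw [← ENNReal.ofReal_natCast, ← ENNReal.ofReal_ofNat 2,
            ← ENNReal.ofReal_mul (by positivity), ← ENNReal.ofReal_pow (by positivity),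
            ← ENNReal.ofReal_mul (by positivity), ← ENNReal.ofReal_mul (by positivity)]
          congr 1
          push_cast
          field_simp
          ring
  induction N with
  | zero => simp
  | succ N ih =>
    set t : ℕ → (Fin 2 → ℤ) → ℝ≥0∞ :=
      fun j x => ENNReal.ofReal (‖z‖ / 2 ^ j) * nearBall (2 ^ j) z x with ht
    change ∑' x, (∑ j ∈ Finset.range N, t j x) ^ 2 ≤ _ at ih
    change ∑' x, (∑ j ∈ Finset.range (N + 1), t j x) ^ 2 ≤ _
    have hc : ∑' x, (∑ j ∈ Finset.range N, t j x) * t N x ≤ ENNReal.ofReal (8 * ‖z‖ ^ 2) := by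
      simp_rw [Finset.sum_mul]
      rw [Summable.tsum_finsetSum fun _ _ => ENNReal.summable]
      refine (Finset.sum_le_sum fun j _ => hcross j N).trans ?_
      rw [← ENNReal.ofReal_sum_of_nonneg fun _ _ => by positivity, ← Finset.mul_sum]
      refine ENNReal.ofReal_le_ofReal ?_
      rw [geom_sum_eq (by norm_num)]
      rw [div_mul_eq_mul_div, div_le_iff₀ (by positivity)]
      have : 0 ≤ 8 * ‖z‖ ^ 2 := by positivity
      nlinarith
    have hd : ∑' x, t N x * t N x ≤ ENNReal.ofReal (8 * ‖z‖ ^ 2) := by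
      refine (hcross N N).trans_eq ?_
      rw [div_mul_cancel₀ _ (by positivity)]
    calc ∑' x, (∑ j ∈ Finset.range (N + 1), t j x) ^ 2
        = ∑' x, (∑ j ∈ Finset.range N, t j x) ^ 2 +
          2 * ∑' x, (∑ j ∈ Finset.range N, t j x) * t N x + ∑' x, t N x * t N x := by
          rw [← ENNReal.tsum_mul_left, ← ENNReal.tsum_add, ← ENNReal.tsum_add]
          refine tsum_congr fun x => ?_
          rw [Finset.sum_range_succ]
          ring
      _ ≤ N * ENNReal.ofReal (24 * ‖z‖ ^ 2) + 2 * ENNReal.ofReal (8 * ‖z‖ ^ 2) +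
          ENNReal.ofReal (8 * ‖z‖ ^ 2) := by gcongr
      _ = _ := by
          have : ENNReal.ofReal (24 * ‖z‖ ^ 2) = 3 * ENNReal.ofReal (8 * ‖z‖ ^ 2) := by
            rw [← ENNReal.ofReal_ofNat 3, ← ENNReal.ofReal_mul (by norm_num)]
            congr 1
            ring
          rw [this]
          push_cast
          ring

lemma exists_test_function_two {G : Type*} (m : G → ℝ≥0∞) (φ : G → Fin 2 → ℤ)
    (hmom : ∑' g, m g * ENNReal.ofReal (‖φ g‖ ^ 2) ≠ ⊤) (ε : ℝ≥0∞) (hε : 0 < ε) :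
    ∃ f : (Fin 2 → ℤ) → ℝ, f 0 = 1 ∧ ∑' x, ENNReal.ofReal (f x ^ 2) ≠ ⊤ ∧
      ∑' g, m g * ∑' x, ENNReal.ofReal ((f (x + φ g) - f x) ^ 2) ≤ ε := by
  let f : ℕ → (Fin 2 → ℤ) → ℝ := fun N x =>
    (∑ j ∈ Finset.range (N + 1), tent (2 ^ j : ℕ) x) / (N + 1 : ℕ)
  have hen : ∀ N z, ∑' x, ENNReal.ofReal ((f N (x + z) - f N x) ^ 2) ≤
      ENNReal.ofReal (24 / (N + 1 : ℕ)) * ENNReal.ofReal (‖z‖ ^ 2) := by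
    intro N z
    have hN : (0 : ℝ) < (N + 1 : ℕ) := by positivity
    calc _ ≤ ∑' x, ENNReal.ofReal ((1 / (N + 1 : ℕ)) ^ 2) * (∑ j ∈ Finset.range (N + 1),
            ENNReal.ofReal (‖z‖ / 2 ^ j) * nearBall (2 ^ j) z x) ^ 2 := by
          refine ENNReal.tsum_le_tsum fun x => ?_
          have : (f N (x + z) - f N x) ^ 2 = (1 / (N + 1 : ℕ)) ^ 2 *
              |∑ j ∈ Finset.range (N + 1), (tent (2 ^ j : ℕ) (x + z) - tent (2 ^ j : ℕ) x)| ^ 2 := by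
            rw [sq_abs, Finset.sum_sub_distrib]
            simp only [f]
            ring
          rw [this, ENNReal.ofReal_mul (by positivity)]
          gcongr
          rw [ENNReal.ofReal_pow (abs_nonneg _)]
          gcongr
          refine (ENNReal.ofReal_le_ofReal (Finset.abs_sum_le_sum_abs _ _)).trans ?_
          rw [ENNReal.ofReal_sum_of_nonneg fun _ _ => abs_nonneg _]
          refine Finset.sum_le_sum fun j _ =>
            (ofReal_abs_tent_sub_le (Nat.two_pow_pos j) z x).trans ?_
          gcongr
          refine (min_le_right _ _).trans_eq ?_
          push_cast
          rfl
      _ ≤ ENNReal.ofReal ((1 / (N + 1 : ℕ)) ^ 2) *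
          ((N + 1 : ℕ) * ENNReal.ofReal (24 * ‖z‖ ^ 2)) := by
          rw [ENNReal.tsum_mul_left]
          gcongr
          exact tsum_dyadic_sq_le z (N + 1)
      _ = _ := by
          rw [← ENNReal.ofReal_natCast (N + 1), ← ENNReal.ofReal_mul (by positivity),
            ← ENNReal.ofReal_mul (by positivity), ← ENNReal.ofReal_mul (by positivity)]
          congr 1
          field_simp
  have hb : Filter.Tendsto (fun N : ℕ => ENNReal.ofReal (24 / (N + 1 : ℕ)) *
      ∑' g, m g * ENNReal.ofReal (‖φ g‖ ^ 2)) Filter.atTop (nhds 0) := by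
    rw [← zero_mul (∑' g, m g * ENNReal.ofReal (‖φ g‖ ^ 2)), ← ENNReal.ofReal_zero]
    exact ENNReal.Tendsto.mul_const (ENNReal.tendsto_ofReal
      ((tendsto_const_div_atTop_nhds_zero_nat _).comp (Filter.tendsto_add_atTop_nat 1)))
      (Or.inr hmom)
  obtain ⟨N, hN⟩ := (hb.eventually (ge_mem_nhds hε)).exists
  have hN0 : (0 : ℝ) < (N + 1 : ℕ) := by positivity
  refine ⟨f N, ?_, tsum_ofReal_sq_ne_top (2 ^ N) _
    (fun x => div_nonneg (Finset.sum_nonneg fun _ _ => tent_nonneg _ _) hN0.le) (fun x => ?_)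
    (fun x hx => ?_), le_trans ?_ hN⟩
  · simp only [f, tent_zero]
    rw [Finset.sum_const, Finset.card_range, nsmul_one, div_self hN0.ne']
  · rw [div_le_one hN0]
    refine (Finset.sum_le_sum fun _ _ => tent_le_one _ _).trans_eq ?_
    simp
  · simp only [f]
    rw [Finset.sum_eq_zero, zero_div]
    intro j hj
    refine tent_eq_zero (Nat.two_pow_pos j) (le_trans ?_ hx)
    exact_mod_cast Nat.pow_le_pow_right two_pos (Finset.mem_range_succ_iff.1 hj)
  · rw [← ENNReal.tsum_mul_left]
    refine ENNReal.tsum_le_tsum fun g => ?_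
    rw [mul_left_comm]
    gcongr
    exact hen N (φ g)

lemma exists_list_length_eq_wordLength {G : Type*} [Group G] {S : Finset G}
    (hS : Subgroup.closure (S : Set G) = ⊤) (g : G) :
    ∃ l : List G, (∀ x ∈ l, x ∈ S ∨ x⁻¹ ∈ S) ∧ l.length = wordLength S g ∧ l.prod = g := by
  have hg : g ∈ Subgroup.closure (S : Set G) := by rw [hS]; trivial
  rw [← Subgroup.mem_toSubmonoid, Subgroup.closure_toSubmonoid] at hg
  obtain ⟨l, hl, hprod⟩ := Submonoid.exists_list_of_mem_closure hg
  exact Nat.sInf_mem (s := {n : ℕ | ∃ l : List G, (∀ x ∈ l, x ∈ S ∨ x⁻¹ ∈ S) ∧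
    l.length = n ∧ l.prod = g}) ⟨l.length, l, hl, rfl, hprod⟩

lemma exists_norm_le_mul_wordLength {G V : Type*} [Group G] [SeminormedAddCommGroup V]
    {S : Finset G} (hS : Subgroup.closure (S : Set G) = ⊤) (φ : G →* Multiplicative V) :
    ∃ C : ℝ, 0 ≤ C ∧ ∀ g, ‖(φ g).toAdd‖ ≤ C * wordLength S g := by
  refine ⟨∑ s ∈ S, ‖(φ s).toAdd‖, Finset.sum_nonneg fun _ _ => norm_nonneg _, fun g => ?_⟩
  set C := ∑ s ∈ S, ‖(φ s).toAdd‖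
  have hC : ∀ x ∈ S, ‖(φ x).toAdd‖ ≤ C := fun x hx =>
    Finset.single_le_sum (f := fun s => ‖(φ s).toAdd‖) (fun _ _ => norm_nonneg _) hx
  have hlist : ∀ l : List G, (∀ x ∈ l, x ∈ S ∨ x⁻¹ ∈ S) → ‖(φ l.prod).toAdd‖ ≤ C * l.length := by
    intro l hl
    induction l with
    | nil => simp
    | cons x l ih =>
      rw [List.prod_cons, map_mul, toAdd_mul, List.length_cons]
      have h1 : ‖(φ x).toAdd‖ ≤ C := by
        rcases hl x (by simp) with h | h
        · exact hC x h
        · simpa using hC _ h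
      have h2 := ih fun y hy => hl y (by simp [hy])
      push_cast
      linarith [norm_add_le (φ x).toAdd (φ l.prod).toAdd]
  obtain ⟨l, hl, hlen, hprod⟩ := exists_list_length_eq_wordLength hS g
  rw [← hlen]
  simpa [hprod] using hlist l hl

lemma tsum_tabooWeight_compl_eq {G V : Type*} [Group G] [AddCommGroup V] (H : Subgroup G)
    (m : G → ℝ≥0∞) (φ : G →* Multiplicative V) (hker : ∀ g, (φ g).toAdd = 0 ↔ g ∈ H) (n : ℕ) :
    ∑' y : ((H : Set G)ᶜ : Set G), tabooWeight H m n 1 y =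
      (killedOp m fun g => (φ g).toAdd)^[n + 1] 1 0 := by
  classical
  have hind : ∀ β : G → ℝ≥0∞, ∑' y : ((H : Set G)ᶜ : Set G), β y =
      ∑' y, if y ∈ H then 0 else β y := by
    intro β
    rw [tsum_subtype ((H : Set G)ᶜ) β]
    refine tsum_congr fun y => ?_
    by_cases hy : y ∈ H <;> simp [hy]
  have hstep : ∀ n (b : V → ℝ≥0∞), ∑' y : ((H : Set G)ᶜ : Set G),
      tabooWeight H m (n + 1) 1 y * b (φ y).toAdd = ∑' y : ((H : Set G)ᶜ : Set G),
        tabooWeight H m n 1 y * killedOp m (fun g => (φ g).toAdd) b (φ y).toAdd := by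
    intro n b
    rw [hind fun y => tabooWeight H m (n + 1) 1 y * b (φ y).toAdd]
    have hite : ∀ y, (if y ∈ H then 0 else tabooWeight H m (n + 1) 1 y * b (φ y).toAdd) =
        tabooWeight H m (n + 1) 1 y * if y ∈ H then 0 else b (φ y).toAdd := fun y => by
      split_ifs <;> simp
    simp_rw [hite]
    rw [tsum_tabooWeight_succ H m n fun y => if y ∈ H then 0 else b (φ y).toAdd]
    simp only [killedOp, ← toAdd_mul, ← map_mul, hker]
  have hmain : ∀ n (b : V → ℝ≥0∞), ∑' y : ((H : Set G)ᶜ : Set G),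
      tabooWeight H m n 1 y * b (φ y).toAdd =
        (killedOp m fun g => (φ g).toAdd)^[n + 1] b 0 := by
    intro n
    induction n with
    | zero =>
      intro b
      rw [hind fun y => tabooWeight H m 0 1 y * b (φ y).toAdd]
      simp [killedOp, hker, tabooWeight]
    | succ n ih =>
      intro b
      rw [hstep, ih, ← Function.iterate_succ_apply]
  simpa using hmain n 1

lemma tsum_mul_measure_preimage {G Y : Type*} [Group G] [MeasurableSpace Y] [MulAction G Y]
    (hmeas : ∀ g : G, Measurable fun y : Y => g • y) (m : G → ℝ≥0∞) (ν : Measure Y)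
    (hstat : Measure.sum (fun g : G => m g • ν.map (g • ·)) = ν) {B : Set Y}
    (hB : MeasurableSet B) (x : G) :
    ∑' g, m g * ν ((fun y => (x * g) • y) ⁻¹' B) = ν ((fun y => x • y) ⁻¹' B) := by
  conv_rhs => rw [← hstat, Measure.sum_apply _ (hmeas x hB)]
  refine tsum_congr fun g => ?_
  rw [Measure.smul_apply, Measure.map_apply (hmeas g) (hmeas x hB), smul_eq_mul]
  simp only [Set.preimage_preimage, mul_smul]

lemma killedOp_tendsto_of_moment {G : Type*} [Group G] (k : ℕ) (hk : k = 1 ∨ k = 2)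
    (S : Finset G) (hS : Subgroup.closure (S : Set G) = ⊤)
    (m : G → ℝ≥0∞) (hm : ∑' g : G, m g = 1) (hsym : ∀ g : G, m g = m g⁻¹)
    (hmom : ∑' g : G, (wordLength S g : ℝ≥0∞) ^ k * m g < ⊤)
    (φ : G →* Multiplicative (Fin k → ℤ)) :
    Filter.Tendsto (fun n => (killedOp m fun g => (φ g).toAdd)^[n] 1 0) Filter.atTop (nhds 0) := by
  obtain ⟨C, hC0, hC⟩ := exists_norm_le_mul_wordLength hS φ
  have hmom' : ∑' g, m g * ENNReal.ofReal (‖(φ g).toAdd‖ ^ k) ≠ ⊤ := by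
    refine ne_top_of_le_ne_top (b := ENNReal.ofReal (C ^ k) *
      ∑' g : G, (wordLength S g : ℝ≥0∞) ^ k * m g) (by finiteness) ?_
    rw [← ENNReal.tsum_mul_left]
    refine ENNReal.tsum_le_tsum fun g => ?_
    rw [mul_comm, ← mul_assoc]
    gcongr
    rw [← ENNReal.ofReal_natCast, ← ENNReal.ofReal_pow (by positivity),
      ← ENNReal.ofReal_mul (by positivity), ← mul_pow]
    gcongr
    exact hC g
  refine iterate_killedOp_tendsto m hm hsym _ (fun g => by simp) fun ε hε => ?_
  rcases hk with rfl | rfl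
  · exact exists_test_function_one m (fun g => ENNReal.ne_top_of_tsum_ne_top (by simp [hm]) g)
      _ (by simpa using hmom') ε hε
  · exact exists_test_function_two m _ hmom' ε hε

/-- **Induced stationary measures on normal subgroups with quotient `ℤᵏ`, `k ∈ {1,2}`**
(Proposition 6.1). Here convolution of a weight function `m` with a measure `ν` on `Y`
is `Measure.sum fun g => m g • ν.map (g • ·)`. -/
theorem exists_symmetric_stationary_on_normal_subgroup {G Y : Type*} [Group G] [Countable G]
    [TopologicalSpace Y] [CompactSpace Y] [TopologicalSpace.MetrizableSpace Y]
    [MeasurableSpace Y] [BorelSpace Y] [MulAction G Y]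
    (hcont : ∀ g : G, Continuous fun y : Y => g • y)
    (H : Subgroup G) [H.Normal] (k : ℕ) (hk : k = 1 ∨ k = 2)
    (hquot : Nonempty ((G ⧸ H) ≃* Multiplicative (Fin k → ℤ)))
    (S : Finset G) (hS : Subgroup.closure (S : Set G) = ⊤)
    (m : G → ℝ≥0∞) (hm : ∑' g : G, m g = 1)
    (hsym : ∀ g : G, m g = m g⁻¹)
    (hgen : Subgroup.closure {g : G | m g ≠ 0} = ⊤)
    (hmom : ∑' g : G, (wordLength S g : ℝ≥0∞) ^ k * m g < ⊤)
    (ν : Measure Y) [IsProbabilityMeasure ν]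
    (hstat : Measure.sum (fun g : G => m g • ν.map (g • ·)) = ν) :
    ∃ m' : G → ℝ≥0∞, (∑' g : G, m' g = 1) ∧ (∀ g : G, m' g = m' g⁻¹) ∧
      {g : G | m' g ≠ 0} ⊆ (H : Set G) ∧
      Subgroup.closure {g : G | m' g ≠ 0} = H ∧
      Measure.sum (fun g : G => m' g • ν.map (g • ·)) = ν := by
  obtain ⟨e⟩ := hquot
  let φ : G →* Multiplicative (Fin k → ℤ) := e.toMonoidHom.comp (QuotientGroup.mk' H)
  have hker : ∀ g, (φ g).toAdd = 0 ↔ g ∈ H := fun g => by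
    rw [toAdd_eq_zero]
    simp [φ]
  have hmeas : ∀ g : G, Measurable fun y : Y => g • y := fun g => (hcont g).measurable
  have hrec : Filter.Tendsto (fun n => ∑' y : ((H : Set G)ᶜ : Set G), tabooWeight H m n 1 y)
      Filter.atTop (nhds 0) := by
    simp_rw [tsum_tabooWeight_compl_eq H m φ hker]
    exact (killedOp_tendsto_of_moment k hk S hS m hm hsym hmom φ).comp
      (Filter.tendsto_add_atTop_nat 1)
  refine ⟨hittingWeight H m, ?_, hittingWeight_inv H m hsym,
    fun g hg => ((hittingWeight_ne_zero_iff H m g).1 hg).1,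
    closure_hittingWeight_support H m hsym hgen, ?_⟩
  · simpa using tsum_hittingWeight_mul H m hrec 1 (fun _ => le_rfl) (fun x => by simpa using hm)
  · ext B hB
    rw [Measure.sum_apply _ hB]
    have := tsum_hittingWeight_mul H m hrec (fun g => ν ((fun y => g • y) ⁻¹' B))
      (fun g => prob_le_one) (tsum_mul_measure_preimage hmeas m ν hstat hB)
    simp only [one_smul, Set.preimage_id'] at this
    rw [← this]
    refine tsum_congr fun g => ?_
    rw [Measure.smul_apply, Measure.map_apply (hmeas g) hB, smul_eq_mul]
end

section
/- Let G be a finitely generated group and H ◁ G a normal subgroup with G/H isomorphic to ℤ^k, where k ∈ {1,2}. Fix a finite generating set of G and let |·| denote the associated word length. Suppose m is a symmetric probability measure on G whose support generates G as a group and which has finite k-th moment (Σ_{g∈G} |g|^k·m(g) < +∞). Then for m^ℕ-almost every sequence (g_n) ∈ G^ℕ, there exists n ≥ 1 with g₁g₂⋯g_n ∈ H; that is, the stopping time τ((g_n)) := inf{n ≥ 1 : g₁⋯g_n ∈ H} is finite m^ℕ-almost everywhere. -/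
open MeasureTheory
open scoped ENNReal

/-- The word `g₁ g₂ ⋯ gₙ` of a one-sided sequence `g : ℕ → G` (indexed from `0`,
so `g i` represents `g_{i+1}`). -/
def wordN {G : Type*} [Group G] (g : ℕ → G) (n : ℕ) : G :=
  ((List.range n).map g).prod

/-- `μ` is the one-sided Bernoulli product measure with marginal the weight
function `m`. -/
def IsBernoulliN {G : Type*} [MeasurableSpace G] (m : G → ℝ≥0∞)
    (μ : Measure (ℕ → G)) : Prop :=
  ∀ (s : Finset ℕ) (f : ℕ → G), μ {x | ∀ i ∈ s, x i = f i} = ∏ i ∈ s, m (f i)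

section RandomWalk

open ProbabilityTheory

variable {Ω E : Type*} {mΩ : MeasurableSpace Ω} {P : Measure Ω}
  [AddCommGroup E] [MeasurableSpace E]

lemma map_shift_eq {E : Type*} [MeasurableSpace E] {X : ℕ → Ω → E}
    (hX : ∀ i, Measurable (X i)) (hind : iIndepFun X P)
    (hid : ∀ i, IdentDistrib (X i) (X 0) P P) (n : ℕ) :
    P.map (fun ω i ↦ X (n + i) ω) = P.map (fun ω i ↦ X i ω) := by
  have h := hind.precomp (g := fun i ↦ n + i) (add_right_injective n)
  rw [hind.map_fun_eq_infinitePi_map hX]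
  refine (iIndepFun.map_fun_eq_infinitePi_map (fun i ↦ hX _) h).trans ?_
  simp only [(hid _).map_eq]

lemma map_neg_eq [MeasurableNeg E] {X : ℕ → Ω → E}
    (hX : ∀ i, Measurable (X i)) (hind : iIndepFun X P)
    (hid : ∀ i, IdentDistrib (X i) (X 0) P P) (hsymm : IdentDistrib (X 0) (-X 0) P P) :
    P.map (fun ω i ↦ -X i ω) = P.map (fun ω i ↦ X i ω) := by
  have h := hind.comp (fun _ x ↦ -x) (fun _ ↦ measurable_neg)
  rw [hind.map_fun_eq_infinitePi_map hX]
  refine (iIndepFun.map_fun_eq_infinitePi_map (fun i ↦ (hX i).neg) h).trans ?_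
  congr 1
  ext1 i
  exact (((hid i).comp measurable_neg).trans hsymm.symm).map_eq.trans (hid i).symm.map_eq

lemma indepFun_sum_range_tail [MeasurableAdd₂ E] {X : ℕ → Ω → E}
    (hX : ∀ i, Measurable (X i)) (hind : iIndepFun X P) (n : ℕ) :
    IndepFun (fun ω ↦ ∑ i ∈ Finset.range n, X i ω) (fun ω i ↦ X (n + i) ω) P := by
  have h := indep_iSup_of_disjoint (fun i ↦ (hX i).comap_le) hind.iIndep
    (S := Set.Iio n) (T := Set.Ici n)
    (Set.disjoint_left.2 fun i hi hj ↦ not_lt.2 (Set.mem_Ici.1 hj) (Set.mem_Iio.1 hi))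
  refine indep_of_indep_of_le_left (indep_of_indep_of_le_right h ?_) ?_
  · rw [MeasurableSpace.pi, MeasurableSpace.comap_iSup]
    refine iSup_le fun i ↦ ?_
    rw [MeasurableSpace.comap_comp]
    exact le_iSup₂_of_le (n + i) (Set.mem_Ici.2 (Nat.le_add_right n i)) le_rfl
  · refine Measurable.comap_le (Finset.measurable_fun_sum _ fun i hi ↦ ?_)
    exact Measurable.mono (comap_measurable (X i))
      (le_iSup₂_of_le i (Set.mem_Iio.2 (Finset.mem_range.1 hi)) le_rfl) le_rfl

lemma tsum_measure_sum_eq_zero_mul_le [MeasurableAdd₂ E] [MeasurableSingletonClass E]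
    [IsProbabilityMeasure P] {X : ℕ → Ω → E}
    (hX : ∀ i, Measurable (X i)) (hind : iIndepFun X P)
    (hid : ∀ i, IdentDistrib (X i) (X 0) P P) :
    (∑' n, P {ω | ∑ i ∈ Finset.range n, X i ω = 0}) *
      P {ω | ∀ n, 1 ≤ n → ∑ i ∈ Finset.range n, X i ω ≠ 0} ≤ 1 := by
  set V : Set (ℕ → E) := {x | ∀ n, 1 ≤ n → ∑ i ∈ Finset.range n, x i ≠ 0} with hV
  have hVm : MeasurableSet V := by
    simp only [hV, Set.ofPred_forall]
    refine .iInter fun n ↦ .iInter fun _ ↦ ?_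
    exact ((Finset.measurable_fun_sum (Finset.range n) fun i _ ↦ measurable_pi_apply i)
      (measurableSet_singleton (0 : E))).compl
  have hSm (n : ℕ) : Measurable fun ω ↦ ∑ i ∈ Finset.range n, X i ω :=
    Finset.measurable_fun_sum _ fun i _ ↦ hX i
  have hTm (n : ℕ) : Measurable fun ω i ↦ X (n + i) ω := measurable_pi_lambda _ fun i ↦ hX _
  set A : ℕ → Set Ω := fun n ↦ (fun ω ↦ ∑ i ∈ Finset.range n, X i ω) ⁻¹' {0} ∩
    (fun ω i ↦ X (n + i) ω) ⁻¹' V with hA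
  have hPA (n : ℕ) : P {ω | ∑ i ∈ Finset.range n, X i ω = 0} *
      P {ω | ∀ n, 1 ≤ n → ∑ i ∈ Finset.range n, X i ω ≠ 0} = P (A n) := by
    rw [hA, (indepFun_sum_range_tail hX hind n).measure_inter_preimage_eq_mul _ _
      (measurableSet_singleton 0) hVm, ← Measure.map_apply (hTm n) hVm,
      map_shift_eq hX hind hid n, Measure.map_apply (measurable_pi_lambda _ hX) hVm]
    rfl
  rw [← ENNReal.tsum_mul_right]
  simp only [hPA]
  refine (tsum_meas_le_meas_iUnion_of_disjoint P (fun n ↦ ?_) ?_).trans prob_le_one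
  · exact (hSm n (measurableSet_singleton 0)).inter (hTm n hVm)
  · refine (pairwise_disjoint_on A).2 fun a b hab ↦ Set.disjoint_left.2 fun ω ha hb ↦ ?_
    have h0 : ∑ i ∈ Finset.range b, X i ω = 0 := hb.1
    have h1 : ∑ i ∈ Finset.range a, X i ω = 0 := ha.1
    obtain ⟨c, rfl⟩ := Nat.exists_eq_add_of_le hab.le
    rw [Finset.sum_range_add, h1, zero_add] at h0
    exact ha.2 c (by omega) h0

lemma ae_exists_sum_eq_zero_of_tsum_eq_top [MeasurableAdd₂ E] [MeasurableSingletonClass E]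
    [IsProbabilityMeasure P] {X : ℕ → Ω → E}
    (hX : ∀ i, Measurable (X i)) (hind : iIndepFun X P)
    (hid : ∀ i, IdentDistrib (X i) (X 0) P P)
    (h : ∑' n, P {ω | ∑ i ∈ Finset.range n, X i ω = 0} = ⊤) :
    ∀ᵐ ω ∂P, ∃ n, 1 ≤ n ∧ ∑ i ∈ Finset.range n, X i ω = 0 := by
  have h1 := tsum_measure_sum_eq_zero_mul_le hX hind hid
  rw [ae_iff]
  push Not
  by_contra h0
  rw [h, ENNReal.top_mul h0] at h1
  exact absurd h1 (by simp)

lemma sq_measureReal_sum_mem_le [MeasurableAdd₂ E] [MeasurableNeg E] [MeasurableSingletonClass E]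
    [IsProbabilityMeasure P] {X : ℕ → Ω → E}
    (hX : ∀ i, Measurable (X i)) (hind : iIndepFun X P)
    (hid : ∀ i, IdentDistrib (X i) (X 0) P P) (hsymm : IdentDistrib (X 0) (-X 0) P P)
    (n : ℕ) (B : Finset E) :
    P.real {ω | ∑ i ∈ Finset.range n, X i ω ∈ B} ^ 2 ≤
      B.card * P.real {ω | ∑ i ∈ Finset.range (2 * n), X i ω = 0} := by
  have hSm (n : ℕ) : Measurable fun ω ↦ ∑ i ∈ Finset.range n, X i ω :=
    Finset.measurable_fun_sum _ fun i _ ↦ hX i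
  have hTm (n : ℕ) : Measurable fun ω i ↦ X (n + i) ω := measurable_pi_lambda _ fun i ↦ hX _
  have hFm : Measurable fun x : ℕ → E ↦ ∑ i ∈ Finset.range n, x i :=
    Finset.measurable_fun_sum _ fun i _ ↦ measurable_pi_apply i
  have hreflect (b : E) : P {ω | ∑ i ∈ Finset.range n, X i ω = b} =
      P {ω | ∑ i ∈ Finset.range n, X (n + i) ω = -b} := by
    have h1 := hFm (measurableSet_singleton (-b))
    have h2 := congrArg (fun μ ↦ μ ((fun x : ℕ → E ↦ ∑ i ∈ Finset.range n, x i) ⁻¹' {-b}))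
      ((map_shift_eq hX hind hid n).trans (map_neg_eq hX hind hid hsymm).symm)
    have hNm : Measurable fun ω i ↦ -X i ω := measurable_pi_lambda _ fun i ↦ (hX i).neg
    rw [Measure.map_apply (hTm n) h1, Measure.map_apply hNm h1] at h2
    refine Eq.trans ?_ h2.symm
    congr 1
    ext ω
    simp
  have hsq (b : E) : P.real {ω | ∑ i ∈ Finset.range n, X i ω = b} ^ 2 =
      P.real ({ω | ∑ i ∈ Finset.range n, X i ω = b} ∩
        {ω | ∑ i ∈ Finset.range n, X (n + i) ω = -b}) := by
    have h1 := (indepFun_sum_range_tail hX hind n).measure_inter_preimage_eq_mul {b}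
      ((fun x : ℕ → E ↦ ∑ i ∈ Finset.range n, x i) ⁻¹' {-b}) (measurableSet_singleton b)
      (hFm (measurableSet_singleton (-b)))
    have h2 : P ({ω | ∑ i ∈ Finset.range n, X i ω = b} ∩
        {ω | ∑ i ∈ Finset.range n, X (n + i) ω = -b}) =
        P {ω | ∑ i ∈ Finset.range n, X i ω = b} *
          P {ω | ∑ i ∈ Finset.range n, X (n + i) ω = -b} := h1
    rw [measureReal_def, measureReal_def, h2, ← hreflect, ENNReal.toReal_mul, sq]
  have hB : P.real {ω | ∑ i ∈ Finset.range n, X i ω ∈ B} =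
      ∑ b ∈ B, P.real {ω | ∑ i ∈ Finset.range n, X i ω = b} :=
    (sum_measureReal_preimage_singleton B fun b _ ↦ hSm n (measurableSet_singleton b)).symm
  rw [hB]
  refine sq_sum_le_card_mul_sum_sq.trans ?_
  gcongr
  simp only [hsq]
  rw [← measureReal_biUnion_finset]
  · refine measureReal_mono ?_
    simp only [Set.iUnion_subset_iff]
    rintro b _ ω ⟨h1, h2⟩
    simp only [Set.mem_ofPred_eq] at h1 h2 ⊢
    rw [two_mul, Finset.sum_range_add, h1, h2, add_neg_cancel]
  · intro a _ b _ hab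
    exact Set.disjoint_left.2 fun ω ha hb ↦ hab (ha.1.symm.trans hb.1)
  · exact fun b _ ↦ (hSm n (measurableSet_singleton b)).inter
      ((hFm.comp (hTm n)) (measurableSet_singleton (-b)))

lemma ae_exists_sum_eq_zero_of_concentration [MeasurableAdd₂ E] [MeasurableNeg E]
    [MeasurableSingletonClass E] [IsProbabilityMeasure P] {X : ℕ → Ω → E}
    (hX : ∀ i, Measurable (X i)) (hind : iIndepFun X P)
    (hid : ∀ i, IdentDistrib (X i) (X 0) P P) (hsymm : IdentDistrib (X 0) (-X 0) P P)
    (C : ℝ) (hC : ∀ n : ℕ, 1 ≤ n → ∃ B : Finset E, (B.card : ℝ) ≤ C * n ∧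
      1 / 2 ≤ P.real {ω | ∑ i ∈ Finset.range n, X i ω ∈ B}) :
    ∀ᵐ ω ∂P, ∃ n, 1 ≤ n ∧ ∑ i ∈ Finset.range n, X i ω = 0 := by
  refine ae_exists_sum_eq_zero_of_tsum_eq_top hX hind hid ?_
  by_contra htop
  have hsum : Summable fun n : ℕ ↦ P.real {ω | ∑ i ∈ Finset.range (2 * n), X i ω = 0} :=
    (ENNReal.summable_toReal htop).comp_injective (mul_right_injective₀ two_ne_zero)
  refine Real.not_summable_one_div_natCast (.of_nonneg_of_le (fun n ↦ by positivity) (fun n ↦ ?_)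
    (hsum.mul_left (4 * C)))
  rcases Nat.eq_zero_or_pos n with rfl | hn
  · obtain ⟨B, hB, -⟩ := hC 1 le_rfl
    have : 0 ≤ C := by simpa using (Nat.cast_nonneg _).trans hB
    simp only [Nat.cast_zero, div_zero]
    positivity
  obtain ⟨B, hB, hP⟩ := hC n hn
  have h1 := sq_measureReal_sum_mem_le hX hind hid hsymm n B
  have h2 : (1 / 2 : ℝ) ^ 2 ≤ P.real {ω | ∑ i ∈ Finset.range n, X i ω ∈ B} ^ 2 := by gcongr
  have h3 : (B.card : ℝ) * P.real {ω | ∑ i ∈ Finset.range (2 * n), X i ω = 0} ≤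
      C * n * P.real {ω | ∑ i ∈ Finset.range (2 * n), X i ω = 0} := by gcongr
  rw [div_le_iff₀ (by positivity)]
  linarith

section Moments

variable {Y : ℕ → Ω → ℝ}

lemma integral_abs_sum_le (hid : ∀ i, IdentDistrib (Y i) (Y 0) P P) (h_int : Integrable (Y 0) P)
    (n : ℕ) : ∫ ω, |∑ i ∈ Finset.range n, Y i ω| ∂P ≤ n * ∫ ω, |Y 0 ω| ∂P := by
  have hi (i : ℕ) : Integrable (Y i) P := (hid i).integrable_iff.2 h_int
  calc ∫ ω, |∑ i ∈ Finset.range n, Y i ω| ∂P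
      ≤ ∫ ω, ∑ i ∈ Finset.range n, |Y i ω| ∂P :=
        integral_mono (integrable_finsetSum _ fun i _ ↦ hi i).abs
          (integrable_finsetSum _ fun i _ ↦ (hi i).abs) fun ω ↦ Finset.abs_sum_le_sum_abs _ _
    _ = n * ∫ ω, |Y 0 ω| ∂P := by
        have h (i : ℕ) : ∫ ω, |Y i ω| ∂P = ∫ ω, |Y 0 ω| ∂P :=
          ((hid i).comp measurable_abs).integral_eq
        simp [integral_finsetSum _ fun i _ ↦ (hi i).abs, h]

lemma integral_sum_sq_eq [IsProbabilityMeasure P] (hind : iIndepFun Y P)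
    (hid : ∀ i, IdentDistrib (Y i) (Y 0) P P) (hL2 : MemLp (Y 0) 2 P) (hmean : P[Y 0] = 0)
    (n : ℕ) : ∫ ω, (∑ i ∈ Finset.range n, Y i ω) ^ 2 ∂P = n * ∫ ω, Y 0 ω ^ 2 ∂P := by
  have hi (i : ℕ) : MemLp (Y i) 2 P := (hid i).memLp_iff.2 hL2
  have hm (i : ℕ) : P[Y i] = 0 := (hid i).integral_eq.trans hmean
  have hsm : P[∑ i ∈ Finset.range n, Y i] = 0 := by
    simp only [Finset.sum_apply]
    rw [integral_finsetSum _ fun i _ ↦ (hi i).integrable one_le_two]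
    exact Finset.sum_eq_zero fun i _ ↦ hm i
  have h := IndepFun.variance_sum (s := Finset.range n) (fun i _ ↦ hi i)
    fun i _ j _ hij ↦ hind.indepFun hij
  rw [variance_of_integral_eq_zero
      (Finset.aemeasurable_sum _ fun i _ ↦ (hi i).aemeasurable) hsm,
    Finset.sum_congr rfl fun i _ ↦ (hid i).variance_eq, Finset.sum_const, Finset.card_range,
    nsmul_eq_mul, variance_of_integral_eq_zero hL2.aemeasurable hmean] at h
  simpa using h

lemma integral_abs_sum_pow_le [IsProbabilityMeasure P] {k : ℕ} (hk : k = 1 ∨ k = 2)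
    (hind : iIndepFun Y P) (hid : ∀ i, IdentDistrib (Y i) (Y 0) P P)
    (hsymm : IdentDistrib (Y 0) (-Y 0) P P) (hLk : MemLp (Y 0) k P) (n : ℕ) :
    ∫ ω, |∑ i ∈ Finset.range n, Y i ω| ^ k ∂P ≤ n * ∫ ω, |Y 0 ω| ^ k ∂P := by
  rcases hk with rfl | rfl
  · simpa using integral_abs_sum_le hid (memLp_one_iff_integrable.1 (by simpa using hLk)) n
  · have hmean : P[Y 0] = 0 := by
      have h := hsymm.integral_eq
      simp only [Pi.neg_apply, integral_neg] at h
      linarith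
    simpa using (integral_sum_sq_eq hind hid (by simpa using hLk) hmean n).le

end Moments

lemma exists_box_concentration [IsProbabilityMeasure P] {k : ℕ} (hk : 1 ≤ k)
    {Z : Ω → Fin k → ℤ} (h_int : ∀ j, Integrable (fun ω ↦ |(Z ω j : ℝ)| ^ k) P)
    {A : ℝ} (hA : 1 ≤ A) (hmom : ∀ j, ∫ ω, |(Z ω j : ℝ)| ^ k ∂P ≤ A) :
    ∃ B : Finset (Fin k → ℤ), (B.card : ℝ) ≤ 3 ^ k * (2 * k * A) ∧
      1 / 2 ≤ P.real {ω | Z ω ∈ B} := by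
  have hk0 : k ≠ 0 := by omega
  have hk1 : (1 : ℝ) ≤ k := by exact_mod_cast hk
  have hR : 1 ≤ 2 * k * A := by nlinarith
  set R : ℝ := 2 * k * A with hRdef
  have hex : ∃ c : ℕ, R ≤ ((c : ℝ) + 1) ^ k := by
    obtain ⟨c, hc⟩ := exists_nat_ge R
    refine ⟨c, (hc.trans (lt_add_one _).le).trans (le_self_pow₀ (by linarith) hk0)⟩
  classical
  set c := Nat.find hex with hcdef
  have hc : R ≤ ((c : ℝ) + 1) ^ k := Nat.find_spec hex
  refine ⟨Finset.Icc (fun _ ↦ -(c : ℤ)) (fun _ ↦ (c : ℤ)), ?_, ?_⟩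
  · have hcard : ((Finset.Icc (fun _ : Fin k ↦ -(c : ℤ)) (fun _ ↦ (c : ℤ))).card : ℝ) =
        (2 * c + 1) ^ k := by
      rw [Pi.card_Icc]
      simp only [Int.card_Icc, Finset.prod_const, Finset.card_univ, Fintype.card_fin]
      rw [show ((c : ℤ) + 1 - -(c : ℤ)).toNat = 2 * c + 1 by omega]
      push_cast
      rfl
    rw [hcard]
    rcases Nat.eq_zero_or_pos c with h0 | h0
    · rw [h0]
      have : (1 : ℝ) ≤ 3 ^ k := one_le_pow₀ (by norm_num)
      simp only [Nat.cast_zero, mul_zero, zero_add, one_pow]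
      nlinarith
    · have hlt : (c : ℝ) ^ k < R := by
        have := Nat.find_min hex (m := c - 1) (by omega)
        rw [not_le, Nat.cast_sub h0] at this
        simpa using this
      have h1 : (1 : ℝ) ≤ c := by exact_mod_cast h0
      calc (2 * (c : ℝ) + 1) ^ k ≤ (3 * c) ^ k := by gcongr; linarith
        _ = 3 ^ k * c ^ k := mul_pow _ _ _
        _ ≤ 3 ^ k * R := by gcongr
  · have hj (j : Fin k) : P.real {ω | R ≤ |(Z ω j : ℝ)| ^ k} ≤ 1 / (2 * k) := by
      have h := mul_meas_ge_le_integral_of_nonneg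
        (ae_of_all P fun ω ↦ by positivity) (h_int j) R
      have h2 := h.trans (hmom j)
      rw [le_div_iff₀ (by positivity)]
      refine le_of_mul_le_mul_left ?_ (zero_lt_one.trans_le hA)
      rw [hRdef] at h2 ⊢
      linarith
    have hcover : (Set.univ : Set Ω) ⊆
        {ω | Z ω ∈ Finset.Icc (fun _ ↦ -(c : ℤ)) (fun _ ↦ (c : ℤ))} ∪
          ⋃ j, {ω | R ≤ |(Z ω j : ℝ)| ^ k} := by
      intro ω _
      by_contra hω
      simp only [Set.mem_union, Set.mem_iUnion, Set.mem_ofPred_eq, not_or, not_exists, not_le,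
        Finset.mem_Icc, Pi.le_def] at hω
      refine hω.1 ?_
      have h (j : Fin k) : |Z ω j| ≤ c := by
        have h2 := lt_of_pow_lt_pow_left₀ k (by positivity) ((hω.2 j).trans_le hc)
        exact Int.lt_add_one_iff.1 (by exact_mod_cast h2)
      exact ⟨fun j ↦ (abs_le.1 (h j)).1, fun j ↦ (abs_le.1 (h j)).2⟩
    have h1 := (measureReal_mono (μ := P) hcover).trans (measureReal_union_le _ _)
    rw [probReal_univ] at h1
    have h2 : P.real (⋃ j, {ω | R ≤ |(Z ω j : ℝ)| ^ k}) ≤ 1 / 2 :=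
      calc _ ≤ ∑ j, P.real {ω | R ≤ |(Z ω j : ℝ)| ^ k} := measureReal_iUnion_fintype_le _
        _ ≤ ∑ _j : Fin k, 1 / (2 * (k : ℝ)) := Finset.sum_le_sum fun j _ ↦ hj j
        _ = 1 / 2 := by
          rw [Finset.sum_const, Finset.card_univ, Fintype.card_fin, nsmul_eq_mul]
          field_simp
    linarith

/-- A symmetric random walk on `ℤᵏ`, `k ∈ {1, 2}`, whose steps have a finite `k`-th moment is
recurrent. -/
theorem ae_exists_sum_eq_zero_of_memLp [IsProbabilityMeasure P] {k : ℕ} (hk : k = 1 ∨ k = 2)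
    {X : ℕ → Ω → Fin k → ℤ} (hX : ∀ i, Measurable (X i)) (hind : iIndepFun X P)
    (hid : ∀ i, IdentDistrib (X i) (X 0) P P) (hsymm : IdentDistrib (X 0) (-X 0) P P)
    (hLk : ∀ j, MemLp (fun ω ↦ (X 0 ω j : ℝ)) k P) :
    ∀ᵐ ω ∂P, ∃ n, 1 ≤ n ∧ ∑ i ∈ Finset.range n, X i ω = 0 := by
  have hk1 : 1 ≤ k := by omega
  set M : ℝ := 1 + ∑ j, ∫ ω, |(X 0 ω j : ℝ)| ^ k ∂P with hM
  have hnonneg (j : Fin k) : 0 ≤ ∫ ω, |(X 0 ω j : ℝ)| ^ k ∂P :=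
    integral_nonneg fun ω ↦ by positivity
  have hM1 : 1 ≤ M := le_add_of_nonneg_right (Finset.sum_nonneg fun j _ ↦ hnonneg j)
  have hMj (j : Fin k) : ∫ ω, |(X 0 ω j : ℝ)| ^ k ∂P ≤ M :=
    (Finset.single_le_sum (fun j _ ↦ hnonneg j) (Finset.mem_univ j)).trans
      (le_add_of_nonneg_left zero_le_one)
  refine ae_exists_sum_eq_zero_of_concentration hX hind hid hsymm (3 ^ k * (2 * k * M))
    fun n hn ↦ ?_
  have hn1 : (1 : ℝ) ≤ n := by exact_mod_cast hn
  have hcoord (j : Fin k) : Measurable fun x : Fin k → ℤ ↦ (x j : ℝ) :=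
    (measurable_from_top (f := fun z : ℤ ↦ (z : ℝ))).comp (measurable_pi_apply j)
  have hidj (j : Fin k) (i : ℕ) :
      IdentDistrib (fun ω ↦ (X i ω j : ℝ)) (fun ω ↦ (X 0 ω j : ℝ)) P P :=
    (hid i).comp (hcoord j)
  have hcast (j : Fin k) (ω : Ω) : (((∑ i ∈ Finset.range n, X i ω) j : ℤ) : ℝ) =
      ∑ i ∈ Finset.range n, (X i ω j : ℝ) := by
    rw [Finset.sum_apply, Int.cast_sum]
  have hbox := exists_box_concentration (P := P) hk1
    (Z := fun ω ↦ ∑ i ∈ Finset.range n, X i ω) (A := n * M) (fun j ↦ ?_) (by nlinarith)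
    fun j ↦ ?_
  · obtain ⟨B, hB, hPB⟩ := hbox
    exact ⟨B, hB.trans (by linarith), hPB⟩
  · simp only [hcast]
    have h : MemLp (fun ω ↦ ∑ i ∈ Finset.range n, (X i ω j : ℝ)) k P :=
      memLp_finsetSum _ fun i _ ↦ (hidj j i).memLp_iff.2 (hLk j)
    simpa using h.integrable_norm_pow (by omega)
  · simp only [hcast]
    refine (integral_abs_sum_pow_le hk (hind.comp (fun _ x ↦ (x j : ℝ)) fun _ ↦ hcoord j)
      (hidj j) ?_ (hLk j) n).trans (by gcongr; exact hMj j)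
    have h := hsymm.comp (hcoord j)
    convert h using 1
    ext ω
    simp

end RandomWalk

open ProbabilityTheory

section Group

variable {G : Type*} [Group G]

lemma exists_list_of_closure_eq_top {S : Finset G} (hS : Subgroup.closure (S : Set G) = ⊤) (g : G) :
    ∃ l : List G, (∀ x ∈ l, x ∈ S ∨ x⁻¹ ∈ S) ∧ l.length = wordLength S g ∧ l.prod = g := by
  refine Nat.sInf_mem
    (s := {n : ℕ | ∃ l : List G, (∀ x ∈ l, x ∈ S ∨ x⁻¹ ∈ S) ∧ l.length = n ∧ l.prod = g}) ?_
  have hg : g ∈ Submonoid.closure ((S : Set G) ∪ (S : Set G)⁻¹) := by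
    rw [← Subgroup.closure_toSubmonoid, hS]
    trivial
  obtain ⟨l, hl, hprod⟩ := Submonoid.exists_list_of_mem_closure hg
  exact ⟨l.length, l, by simpa using hl, rfl, hprod⟩

lemma abs_le_mul_wordLength {S : Finset G} (hS : Subgroup.closure (S : Set G) = ⊤)
    (f : G →* Multiplicative ℤ) (g : G) :
    |(f g).toAdd| ≤ (∑ s ∈ S, |(f s).toAdd|) * wordLength S g := by
  obtain ⟨l, hl, hlen, rfl⟩ := exists_list_of_closure_eq_top hS g
  rw [← hlen]
  clear hlen
  induction l with
  | nil => simp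
  | cons x l ih =>
    rw [List.prod_cons, map_mul, toAdd_mul, List.length_cons]
    have h1 := ih fun y hy ↦ hl y (List.mem_cons_of_mem x hy)
    have h2 : |(f x).toAdd| ≤ ∑ s ∈ S, |(f s).toAdd| := by
      have hle (s : G) (hs : s ∈ S) : |(f s).toAdd| ≤ ∑ s ∈ S, |(f s).toAdd| :=
        Finset.single_le_sum (f := fun s ↦ |(f s).toAdd|) (fun _ _ ↦ abs_nonneg _) hs
      rcases hl x List.mem_cons_self with hx | hx
      · exact hle x hx
      · simpa using hle x⁻¹ hx
    push_cast
    linarith [abs_add_le (f x).toAdd (f l.prod).toAdd]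

lemma toAdd_map_wordN {A : Type*} [AddCommGroup A] (f : G →* Multiplicative A) (g : ℕ → G)
    (n : ℕ) : (f (wordN g n)).toAdd = ∑ i ∈ Finset.range n, (f (g i)).toAdd := by
  induction n with
  | zero => simp [wordN]
  | succ n ih =>
    rw [Finset.sum_range_succ, ← ih]
    simp [wordN, List.range_succ]

end Group

section Bernoulli

variable {G : Type*} [MeasurableSpace G] {m : G → ℝ≥0∞} {μN : Measure (ℕ → G)}

lemma IsBernoulliN.measure_eval_eq (hBern : IsBernoulliN m μN) (i : ℕ) (a : G) :
    μN {x | x i = a} = m a := by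
  simpa using hBern {i} fun _ ↦ a

variable [Countable G] [DiscreteMeasurableSpace G]

lemma IsBernoulliN.map_eval_singleton (hBern : IsBernoulliN m μN) (i : ℕ) (a : G) :
    μN.map (fun x ↦ x i) {a} = m a := by
  rw [Measure.map_apply (measurable_pi_apply i) (measurableSet_singleton a)]
  exact hBern.measure_eval_eq i a

lemma IsBernoulliN.identDistrib_eval (hBern : IsBernoulliN m μN) (i j : ℕ) :
    IdentDistrib (fun x ↦ x i) (fun x ↦ x j) μN μN where
  aemeasurable_fst := (measurable_pi_apply i).aemeasurable
  aemeasurable_snd := (measurable_pi_apply j).aemeasurable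
  map_eq := Measure.ext_of_singleton fun a ↦ by
    rw [hBern.map_eval_singleton, hBern.map_eval_singleton]

lemma IsBernoulliN.iIndepFun_eval [Inhabited G] [IsProbabilityMeasure μN]
    (hBern : IsBernoulliN m μN) :
    iIndepFun (fun i (x : ℕ → G) ↦ x i) μN := by
  rw [iIndepFun_iff_finset]
  intro s
  have hmeas (i : s) : Measurable fun x : ℕ → G ↦ x i := measurable_pi_apply _
  refine (iIndepFun_iff_map_fun_eq_pi_map fun i : s ↦ (hmeas i).aemeasurable).2 ?_
  have (i : s) : IsProbabilityMeasure (μN.map fun x ↦ x i) :=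
    Measure.isProbabilityMeasure_map (hmeas i).aemeasurable
  refine Measure.ext_of_singleton fun a ↦ ?_
  rw [Measure.map_apply (measurable_pi_lambda _ hmeas) (measurableSet_singleton a),
    Measure.pi_singleton]
  have h := hBern s fun i ↦ if hi : i ∈ s then a ⟨i, hi⟩ else default
  rw [← Finset.prod_coe_sort] at h
  simp only [Subtype.coe_eta, Finset.coe_mem, dite_true] at h
  simp only [hBern.map_eval_singleton]
  rw [← h]
  congr 1
  ext x
  simp only [Set.mem_preimage, Set.mem_singleton_iff, funext_iff, Subtype.forall,
    Set.mem_ofPred_eq]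
  refine forall₂_congr fun i hi ↦ ?_
  simp [hi]

variable [Group G]

lemma IsBernoulliN.identDistrib_eval_inv (hBern : IsBernoulliN m μN)
    (hsym : ∀ g : G, m g = m g⁻¹) (i : ℕ) :
    IdentDistrib (fun x ↦ x i) (fun x ↦ (x i)⁻¹) μN μN where
  aemeasurable_fst := (measurable_pi_apply i).aemeasurable
  aemeasurable_snd := ((Measurable.of_discrete (f := fun g : G ↦ g⁻¹)).comp
    (measurable_pi_apply i)).aemeasurable
  map_eq := Measure.ext_of_singleton fun a ↦ by
    have hinv : Measurable fun x : ℕ → G ↦ (x i)⁻¹ :=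
      (Measurable.of_discrete (f := fun g : G ↦ g⁻¹)).comp (measurable_pi_apply i)
    rw [hBern.map_eval_singleton, hsym, ← hBern.measure_eval_eq i,
      Measure.map_apply hinv (measurableSet_singleton a)]
    congr 1
    ext x
    simp [inv_eq_iff_eq_inv]

lemma IsBernoulliN.memLp_map_eval (hBern : IsBernoulliN m μN) {S : Finset G}
    (hS : Subgroup.closure (S : Set G) = ⊤) {k : ℕ} (hk : k ≠ 0)
    (hmom : ∑' g : G, (wordLength S g : ℝ≥0∞) ^ k * m g < ⊤) (f : G →* Multiplicative ℤ) (i : ℕ) :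
    MemLp (fun x ↦ ((f (x i)).toAdd : ℝ)) k μN := by
  have hfm : Measurable fun g : G ↦ ((f g).toAdd : ℝ) := .of_discrete
  refine ⟨(hfm.comp (measurable_pi_apply i)).aestronglyMeasurable, ?_⟩
  rw [eLpNorm_lt_top_iff_lintegral_rpow_enorm_lt_top (by exact_mod_cast hk)
    (ENNReal.natCast_ne_top k)]
  simp only [ENNReal.toReal_natCast, ENNReal.rpow_natCast]
  rw [← lintegral_map (f := fun g : G ↦ ‖((f g).toAdd : ℝ)‖ₑ ^ k) .of_discrete
    (measurable_pi_apply i), lintegral_countable']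
  simp only [hBern.map_eval_singleton]
  set C : ℕ := (∑ s ∈ S, |(f s).toAdd|).toNat with hC
  have hbound (g : G) : ‖((f g).toAdd : ℝ)‖ₑ ≤ C * wordLength S g := by
    have h : |(f g).toAdd| ≤ (C : ℤ) * wordLength S g := by
      rw [hC, Int.toNat_of_nonneg (Finset.sum_nonneg fun _ _ ↦ abs_nonneg _)]
      exact abs_le_mul_wordLength hS f g
    have h' : ‖((f g).toAdd : ℝ)‖ ≤ ((C * wordLength S g : ℕ) : ℝ) := by
      rw [Real.norm_eq_abs]
      exact_mod_cast h
    rw [← ofReal_norm]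
    exact (ENNReal.ofReal_le_ofReal h').trans (by rw [ENNReal.ofReal_natCast]; push_cast; rfl)
  calc ∑' g, ‖((f g).toAdd : ℝ)‖ₑ ^ k * m g
      ≤ ∑' g, (C : ℝ≥0∞) ^ k * ((wordLength S g : ℝ≥0∞) ^ k * m g) := by
        refine ENNReal.tsum_le_tsum fun g ↦ ?_
        rw [← mul_assoc, ← mul_pow]
        gcongr
        exact hbound g
    _ = (C : ℝ≥0∞) ^ k * ∑' g, (wordLength S g : ℝ≥0∞) ^ k * m g := ENNReal.tsum_mul_left
    _ < ⊤ := ENNReal.mul_lt_top (ENNReal.pow_lt_top (ENNReal.natCast_lt_top C)) hmom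

end Bernoulli

/-- **Almost sure finiteness of the first-entry time into a normal subgroup with
quotient `ℤᵏ`, `k ∈ {1,2}`** (Lemma 6.2). -/
theorem ae_exists_firstEntry {G : Type*} [Group G] [Countable G]
    [MeasurableSpace G] [DiscreteMeasurableSpace G]
    (H : Subgroup G) [H.Normal] (k : ℕ) (hk : k = 1 ∨ k = 2)
    (hquot : Nonempty ((G ⧸ H) ≃* Multiplicative (Fin k → ℤ)))
    (S : Finset G) (hS : Subgroup.closure (S : Set G) = ⊤)
    (m : G → ℝ≥0∞) (hm : ∑' g : G, m g = 1)
    (hsym : ∀ g : G, m g = m g⁻¹)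
    (hgen : Subgroup.closure {g : G | m g ≠ 0} = ⊤)
    (hmom : ∑' g : G, (wordLength S g : ℝ≥0∞) ^ k * m g < ⊤)
    (μN : Measure (ℕ → G)) [IsProbabilityMeasure μN] (hBern : IsBernoulliN m μN) :
    ∀ᵐ g ∂μN, ∃ n : ℕ, 1 ≤ n ∧ wordN g n ∈ H := by
  obtain ⟨e⟩ := hquot
  have : Inhabited G := ⟨1⟩
  set φ : G →* Multiplicative (Fin k → ℤ) := e.toMonoidHom.comp (QuotientGroup.mk' H) with hφ
  have hφm : Measurable fun g : G ↦ (φ g).toAdd := .of_discrete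
  have hφH (g : G) : (φ g).toAdd = 0 ↔ g ∈ H := by
    simp [hφ, QuotientGroup.eq_one_iff]
  have hsymm : IdentDistrib (fun x : ℕ → G ↦ (φ (x 0)).toAdd) (-fun x ↦ (φ (x 0)).toAdd)
      μN μN := by
    convert! (hBern.identDistrib_eval_inv hsym 0).comp hφm using 1
    ext x j
    simp
  have hrec := ae_exists_sum_eq_zero_of_memLp (P := μN) hk
    (X := fun i x ↦ (φ (x i)).toAdd) (fun i ↦ hφm.comp (measurable_pi_apply i))
    (hBern.iIndepFun_eval.comp (fun _ g ↦ (φ g).toAdd) fun _ ↦ hφm)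
    (fun i ↦ (hBern.identDistrib_eval i 0).comp hφm) hsymm
    fun j ↦ hBern.memLp_map_eval hS (by omega) hmom
      ((AddMonoidHom.toMultiplicative (Pi.evalAddMonoidHom (fun _ ↦ ℤ) j)).comp φ) 0
  filter_upwards [hrec] with x ⟨n, hn, hsum⟩
  exact ⟨n, hn, (hφH _).1 ((toAdd_map_wordN φ x n).trans hsum)⟩
end

section
/- Let G be a countable group acting by homeomorphisms on a compact metrizable space Y, let m be a probability measure on G, and let ν be an m-stationary Borel probability measure on Y. Let H ≤ G be a subgroup and suppose the stopping time τ((g_n)) := inf{n ≥ 1 : g₁⋯g_n ∈ H} is finite for m^ℕ-almost every (g_n) ∈ G^ℕ. Define ξ : G^ℕ → H (m^ℕ-a.e.) by ξ((g_n)) = g₁g₂⋯g_{τ((g_n))}, and let m' := ξ_* m^ℕ be the pushforward probability measure on H. Then m' * ν = ν. -/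
open MeasureTheory
open scoped ENNReal

/-- `n` is the first-entry time `τ` of the random walk `x` into `H`:
`n ≥ 1`, `g₁⋯gₙ ∈ H` and `g₁⋯gⱼ ∉ H` for `1 ≤ j < n`. -/
def FirstEntry {G : Type*} [Group G] (H : Subgroup G) (x : ℕ → G) (n : ℕ) : Prop :=
  1 ≤ n ∧ wordN x n ∈ H ∧ ∀ j : ℕ, 1 ≤ j → j < n → wordN x j ∉ H

section FirstReturn

variable {G : Type*} [Group G]

lemma wordN_succ (x : ℕ → G) (n : ℕ) : wordN x (n + 1) = wordN x n * x n := by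
  simp [wordN, List.range_succ]

lemma FirstEntry.unique {H : Subgroup G} {x : ℕ → G} {n k : ℕ}
    (hn : FirstEntry H x n) (hk : FirstEntry H x k) : n = k := by
  rcases lt_trichotomy n k with h | h | h
  · exact absurd hn.2.1 (hk.2.2 n hn.1 h)
  · exact h
  · exact absurd hk.2.1 (hn.2.2 k hk.1 h)

open Classical in
/-- The random walk with increments `x`, frozen once it has entered `H` at a positive time. -/
noncomputable def stoppedWord (H : Subgroup G) (x : ℕ → G) : ℕ → G
  | 0 => 1
  | n + 1 => if 1 ≤ n ∧ stoppedWord H x n ∈ H then stoppedWord H x n else stoppedWord H x n * x n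

lemma stoppedWord_congr (H : Subgroup G) {x y : ℕ → G} {n : ℕ} (h : ∀ i < n, x i = y i) :
    stoppedWord H x n = stoppedWord H y n := by
  induction n with
  | zero => rfl
  | succ n ih =>
    rw [stoppedWord, stoppedWord, ih fun i hi => h i (hi.trans n.lt_succ_self),
      h n n.lt_succ_self]

lemma FirstEntry.stoppedWord_of_le {H : Subgroup G} {x : ℕ → G} {k : ℕ} (hk : FirstEntry H x k)
    {n : ℕ} (hn : n ≤ k) : stoppedWord H x n = wordN x n := by
  induction n with
  | zero => rfl
  | succ n ih =>
    rw [stoppedWord, ih (by lia), wordN_succ, if_neg]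
    exact fun h => hk.2.2 n h.1 (by lia) h.2

lemma FirstEntry.stoppedWord_of_ge {H : Subgroup G} {x : ℕ → G} {k : ℕ} (hk : FirstEntry H x k)
    {n : ℕ} (hn : k ≤ n) : stoppedWord H x n = wordN x k := by
  induction n, hn using Nat.le_induction with
  | base => exact hk.stoppedWord_of_le le_rfl
  | succ n hn ih =>
    rw [stoppedWord, ih, if_pos ⟨hk.1.trans hn, hk.2.1⟩]

variable [Countable G] [MeasurableSpace G] [DiscreteMeasurableSpace G]

lemma measurable_wordN (n : ℕ) : Measurable fun x : ℕ → G => wordN x n := by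
  induction n with
  | zero => exact measurable_const
  | succ n ih =>
    simp only [wordN_succ]
    exact (measurable_of_countable fun p : G × G => p.1 * p.2).comp
      (ih.prodMk (measurable_pi_apply n))

open Classical in
lemma measurable_stoppedWord (H : Subgroup G) (n : ℕ) :
    Measurable fun x : ℕ → G => stoppedWord H x n := by
  induction n with
  | zero => exact measurable_const
  | succ n ih =>
    exact (measurable_of_countable fun p : G × G =>
      if 1 ≤ n ∧ p.1 ∈ H then p.1 else p.1 * p.2).comp (ih.prodMk (measurable_pi_apply n))

lemma measurableSet_firstEntry_eq (H : Subgroup G) (h : G) :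
    MeasurableSet {x : ℕ → G | ∃ n : ℕ, FirstEntry H x n ∧ wordN x n = h} := by
  have hw (n : ℕ) (s : Set G) : MeasurableSet {x : ℕ → G | wordN x n ∈ s} :=
    measurable_wordN n (MeasurableSet.of_discrete (s := s))
  have heq : {x : ℕ → G | ∃ n : ℕ, FirstEntry H x n ∧ wordN x n = h} =
      ⋃ n : ℕ, ⋃ _ : 1 ≤ n, ({x | wordN x n ∈ (H : Set G)} ∩
        ⋂ j : ℕ, ⋂ _ : 1 ≤ j, ⋂ _ : j < n, {x | wordN x j ∈ (H : Set G)ᶜ}) ∩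
          {x | wordN x n ∈ ({h} : Set G)} := by
    ext x
    simp only [FirstEntry, Set.mem_ofPred_eq, Set.mem_iUnion, Set.mem_iInter, Set.mem_inter_iff,
      Set.mem_compl_iff, Set.mem_singleton_iff, SetLike.mem_coe, exists_prop, and_assoc]
  rw [heq]
  exact .iUnion fun n => .iUnion fun _ => ((hw n _).inter
    (.iInter fun j => .iInter fun _ => .iInter fun _ => hw j _)).inter (hw n _)

namespace IsBernoulliN

variable {m : G → ℝ≥0∞} {μ : Measure (ℕ → G)}

/-- Extend a finite sequence by the identity. -/
def extendOne {n : ℕ} (q : Fin n → G) (i : ℕ) : G := if h : i < n then q ⟨i, h⟩ else 1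

lemma lintegral_eq_tsum (hμ : IsBernoulliN m μ) (n : ℕ) (F : (ℕ → G) → ℝ≥0∞)
    (hF : ∀ x y : ℕ → G, (∀ i < n, x i = y i) → F x = F y) :
    ∫⁻ x, F x ∂μ = ∑' q : Fin n → G, F (extendOne q) * ∏ i, m (q i) := by
  let r : (ℕ → G) → (Fin n → G) := fun x i => x i
  have hr : Measurable r := measurable_pi_lambda _ fun i => measurable_pi_apply _
  have h1 : ∀ x, F x = F (extendOne (r x)) := fun x =>
    hF _ _ fun i hi => by simp [extendOne, hi, r]
  have h2 : ∫⁻ x, F x ∂μ = ∫⁻ q, F (extendOne q) ∂(μ.map r) := by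
    rw [lintegral_map (measurable_of_countable _) hr]
    exact lintegral_congr h1
  rw [h2, lintegral_countable']
  refine tsum_congr fun q => ?_
  rw [Measure.map_apply hr (measurableSet_singleton q)]
  have h3 : r ⁻¹' {q} = {x | ∀ i ∈ Finset.range n, x i = extendOne q i} := by
    ext x
    simp only [Set.mem_preimage, Set.mem_singleton_iff, Finset.mem_range, Set.mem_ofPred_eq,
      funext_iff, r]
    constructor
    · intro h i hi
      simpa [extendOne, hi] using h ⟨i, hi⟩
    · intro h i
      simpa [extendOne] using h i i.2
  rw [h3, hμ, Finset.prod_range]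
  simp [extendOne]

/-- The `n`-th increment is independent of the previous ones and has law `m`. -/
lemma lintegral_step (hμ : IsBernoulliN m μ) (n : ℕ) (Φ : (ℕ → G) → G → ℝ≥0∞)
    (hΦ : ∀ x y : ℕ → G, (∀ i < n, x i = y i) → Φ x = Φ y) :
    ∫⁻ x, Φ x (x n) ∂μ = ∫⁻ x, ∑' k, m k * Φ x k ∂μ := by
  rw [hμ.lintegral_eq_tsum (n + 1) _ fun x y h => by
      rw [hΦ x y fun i hi => h i (by lia), h n n.lt_succ_self],
    hμ.lintegral_eq_tsum n _ fun x y h => by rw [hΦ x y h],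
    ← (Fin.snocEquiv fun _ : Fin (n + 1) => G).tsum_eq, ENNReal.tsum_prod', ENNReal.tsum_comm]
  refine tsum_congr fun q => ?_
  rw [← ENNReal.tsum_mul_right]
  refine tsum_congr fun k => ?_
  have h1 : Φ (extendOne (Fin.snoc q k : Fin (n + 1) → G)) = Φ (extendOne q) :=
    hΦ _ _ fun i hi => by simp [extendOne, hi, Fin.snoc, hi.trans n.lt_succ_self]
  have h2 : extendOne (Fin.snoc q k : Fin (n + 1) → G) n = k := by simp [extendOne, Fin.snoc]
  have h0 : (Fin.snocEquiv fun _ : Fin (n + 1) => G) (k, q) = Fin.snoc q k := rfl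
  rw [h0, h1, h2, Fin.prod_univ_castSucc]
  simp only [Fin.snoc_castSucc, Fin.snoc_last]
  ring

lemma lintegral_stoppedWord [IsProbabilityMeasure μ] (hμ : IsBernoulliN m μ)
    (hm : ∑' g, m g = 1) (H : Subgroup G) (f : G → ℝ≥0∞)
    (hf : ∀ g, ∑' k, m k * f (g * k) = f g) (n : ℕ) :
    ∫⁻ x, f (stoppedWord H x n) ∂μ = f 1 := by
  classical
  induction n with
  | zero => simp [stoppedWord]
  | succ n ih =>
    rw [← ih]
    refine (hμ.lintegral_step n (fun x k => f (if 1 ≤ n ∧ stoppedWord H x n ∈ H then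
      stoppedWord H x n else stoppedWord H x n * k)) fun x y h => by
        simp only [stoppedWord_congr H h]).trans (lintegral_congr fun x => ?_)
    split_ifs
    · rw [ENNReal.tsum_mul_right, hm, one_mul]
    · exact hf _

/-- Optional stopping for a bounded harmonic function at the first entry time into `H`. -/
lemma tsum_firstEntry_mul [IsProbabilityMeasure μ] (hμ : IsBernoulliN m μ)
    (hm : ∑' g, m g = 1) (H : Subgroup G) (hτ : ∀ᵐ x ∂μ, ∃ n : ℕ, FirstEntry H x n)
    (f : G → ℝ≥0∞) (hf : ∀ g, ∑' k, m k * f (g * k) = f g) (hf1 : ∀ g, f g ≤ 1) :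
    ∑' h, μ {x | ∃ n : ℕ, FirstEntry H x n ∧ wordN x n = h} * f h = f 1 := by
  set E : G → Set (ℕ → G) := fun h => {x | ∃ n : ℕ, FirstEntry H x n ∧ wordN x n = h} with hE
  have hEm (h : G) : MeasurableSet (E h) := measurableSet_firstEntry_eq H h
  have hsum : ∑' h, μ (E h) * f h = ∫⁻ x, ∑' h, (E h).indicator (fun _ => f h) x ∂μ := by
    rw [lintegral_tsum fun h => (measurable_const.indicator (hEm h)).aemeasurable]
    exact tsum_congr fun h => by rw [lintegral_indicator_const (hEm h), mul_comm]
  have hlim : Filter.Tendsto (fun n => ∫⁻ x, f (stoppedWord H x n) ∂μ) Filter.atTop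
      (nhds (∫⁻ x, ∑' h, (E h).indicator (fun _ => f h) x ∂μ)) := by
    refine tendsto_lintegral_of_dominated_convergence (fun _ => 1)
      (fun n => (measurable_of_countable f).comp (measurable_stoppedWord H n))
      (fun n => .of_forall fun x => hf1 _) (by simp) ?_
    filter_upwards [hτ] with x ⟨k, hk⟩
    have hx : ∑' h, (E h).indicator (fun _ => f h) x = f (wordN x k) := by
      rw [tsum_eq_single (wordN x k)]
      · exact Set.indicator_of_mem (show x ∈ E (wordN x k) from ⟨k, hk, rfl⟩) _
      · rintro h hne
        refine Set.indicator_of_notMem ?_ _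
        rintro ⟨n, hn, rfl⟩
        exact hne (by rw [hn.unique hk])
    rw [hx]
    exact tendsto_atTop_of_eventually_const (i₀ := k) fun n hn => by
      rw [hk.stoppedWord_of_ge hn]
  rw [hsum]
  refine tendsto_nhds_unique hlim ?_
  simp only [hμ.lintegral_stoppedWord hm H f hf]
  exact tendsto_const_nhds

end IsBernoulliN

end FirstReturn

/-- **The first-return distribution `m' = ξ_* m^ℕ` on `H` is again `ν`-stationary**
(Lemma 6.3). Here `m' h = μN {x | ξ x = h}` and convolution of a weight function with
a measure `ν` on `Y` is `Measure.sum fun g => m g • ν.map (g • ·)`. -/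
theorem firstReturn_pushforward_stationary {G Y : Type*} [Group G] [Countable G]
    [MeasurableSpace G] [DiscreteMeasurableSpace G]
    [TopologicalSpace Y] [CompactSpace Y] [TopologicalSpace.MetrizableSpace Y]
    [MeasurableSpace Y] [BorelSpace Y] [MulAction G Y]
    (hcont : ∀ g : G, Continuous fun y : Y => g • y)
    (m : G → ℝ≥0∞) (hm : ∑' g : G, m g = 1)
    (ν : Measure Y) [IsProbabilityMeasure ν]
    (hstat : Measure.sum (fun g : G => m g • ν.map (g • ·)) = ν)
    (H : Subgroup G)
    (μN : Measure (ℕ → G)) [IsProbabilityMeasure μN] (hBern : IsBernoulliN m μN)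
    (hτ : ∀ᵐ x ∂μN, ∃ n : ℕ, FirstEntry H x n) :
    Measure.sum (fun h : G =>
      μN {x : ℕ → G | ∃ n : ℕ, FirstEntry H x n ∧ wordN x n = h} • ν.map (h • ·)) = ν := by
  have hmeas (g : G) : Measurable fun y : Y => g • y := (hcont g).measurable
  ext A hA
  rw [Measure.sum_apply _ hA]
  simp only [Measure.smul_apply, smul_eq_mul]
  refine (hBern.tsum_firstEntry_mul hm H hτ (fun g => ν.map (g • ·) A) (fun g => ?_)
    fun g => ?_).trans (by simp)
  · have hgA : MeasurableSet ((g • · : Y → Y) ⁻¹' A) := hmeas g hA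
    rw [Measure.map_apply (hmeas g) hA]
    conv_rhs => rw [← hstat, Measure.sum_apply _ hgA]
    refine tsum_congr fun k => ?_
    rw [Measure.smul_apply, smul_eq_mul, Measure.map_apply (hmeas _) hA,
      Measure.map_apply (hmeas k) hgA]
    simp only [Set.preimage_preimage, mul_smul]
  · rw [Measure.map_apply (hmeas g) hA]
    exact prob_le_one
end
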